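/- arXiv:1404.0599 — 5 statements merged into one kernel-verified Lean document; each statement's English description precedes it below -/
import Mathlib

section
/- Let l be a compact metric space. Then there exists a continuous and locally injective map T : l → ℝ (i.e., a continuous T together with δ > 0 such that 0 < dist(x,y) < δ implies T(x) ≠ T(y)) if and only if l is homeomorphic to a subset of ℝ (i.e., there exists a topological embedding of l into ℝ). -/
open Metric Set Filter Topology

theorem isPreconnected_sInter_of_isChain {X : Type*} [TopologicalSpace X] [T2Space X]
    [CompactSpace X] {c : Set (Set X)} (hne : c.Nonempty) (hchain : IsChain (· ⊆ ·) c)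
    (hcl : ∀ C ∈ c, IsClosed C) (hpre : ∀ C ∈ c, IsPreconnected C) :
    IsPreconnected (⋂₀ c) := by
  rw [isPreconnected_iff_subset_of_fully_disjoint_closed (isClosed_sInter hcl)]
  intro u v hu hv huv hd
  obtain ⟨U, V, hU, hV, huU, hvV, hUV⟩ := SeparatedNhds.of_isCompact_isCompact hu.isCompact
    hv.isCompact hd
  have : Nonempty c := hne.to_subtype
  obtain ⟨⟨C, hCc⟩, hC⟩ := exists_subset_nhds_of_isCompact (V := fun C : c => (C : Set X))
    (U := U ∪ V)
    (fun A B => (hchain.total A.2 B.2).elim (fun h => ⟨A, Subset.rfl, h⟩)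
      fun h => ⟨B, h, Subset.rfl⟩) (fun C => (hcl C C.2).isCompact)
    (fun x hx => (hU.union hV).mem_nhds <| by
      have : x ∈ ⋂₀ c := by rwa [sInter_eq_iInter]
      exact (huv this).imp (@huU x) (@hvV x))
  have hsub : ⋂₀ c ⊆ C := sInter_subset_of_mem hCc
  rcases isPreconnected_iff_subset_of_disjoint.1 (hpre C hCc) U V hU hV hC
    (by rw [hUV.inter_eq, inter_empty]) with h | h
  · exact Or.inl fun x hx => (huv hx).resolve_right
      fun hxv => disjoint_left.1 hUV (h (hsub hx)) (hvV hxv)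
  · exact Or.inr fun x hx => (huv hx).resolve_left
      fun hxu => disjoint_left.1 hUV (huU hxu) (h (hsub hx))

/-- If a locally injective function exceeds `t` on a closed connected set, a cap around a maximum
can be removed from above level `t` without disconnecting the set. -/
theorem exists_isPreconnected_ssubset_of_lt {X : Type*} [MetricSpace X] [CompactSpace X]
    {T : X → ℝ} (hT : Continuous T) {δ : ℝ} (hδ : 0 < δ)
    (hinj : ∀ x y, dist x y < δ → T x = T y → x = y) {K : Set X} (hK : IsClosed K)
    (hKc : IsPreconnected K) {t : ℝ} (hlt : ∃ z ∈ K, t < T z) :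
    ∃ K' ⊂ K, IsClosed K' ∧ IsPreconnected K' ∧ ∀ x ∈ K, T x ≤ t → x ∈ K' := by
  obtain ⟨z, hzK, hzt⟩ := hlt
  obtain ⟨p, hpK, hp⟩ := hK.isCompact.exists_isMaxOn ⟨z, hzK⟩ hT.continuousOn
  have hpt : t < T p := hzt.trans_le (hp hzK)
  obtain ⟨r, hr, hrδ⟩ : ∃ r > 0, 2 * r < δ := ⟨δ / 3, by positivity, by linarith⟩
  obtain ⟨s, hts, hsp, hs⟩ : ∃ s, t < s ∧ s < T p ∧ ∀ w ∈ K, dist w p = r → T w < s := by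
    have hlt : ∀ w ∈ K, dist w p = r → T w < T p := fun w hw hwr =>
      lt_of_le_of_ne (hp hw) fun h => by
        have := hinj w p (by linarith) h
        rw [this, dist_self] at hwr
        exact hr.ne hwr
    rcases (K ∩ sphere p r).eq_empty_or_nonempty with he | hne
    · obtain ⟨s, h1, h2⟩ := exists_between hpt
      exact ⟨s, h1, h2, fun w hw hwr => absurd (show w ∈ K ∩ sphere p r from ⟨hw, hwr⟩)
        (by simp [he])⟩
    · obtain ⟨q, ⟨hqK, hqr⟩, hq⟩ :=
        (hK.inter isClosed_sphere).isCompact.exists_isMaxOn hne hT.continuousOn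
      obtain ⟨s, h1, h2⟩ := exists_between (max_lt hpt (hlt q hqK hqr))
      exact ⟨s, (le_max_left _ _).trans_lt h1, h2, fun w hw hwr =>
        lt_of_le_of_lt (hq ⟨hw, hwr⟩) ((le_max_right _ _).trans_lt h1)⟩
  set J : Set X := {w | dist w p < r ∧ s < T w} with hJ
  set L : Set X := K ∩ {w | dist w p ≤ r ∧ s ≤ T w} with hL
  have hJo : IsOpen J :=
    isOpen_ball.inter (isOpen_lt continuous_const hT)
  have hLc : IsClosed L := hK.inter <|
    isClosed_closedBall.inter (isClosed_le continuous_const hT)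
  have hpJ : p ∈ J := ⟨by simpa using hr, hsp⟩
  have hK'c : IsClosed (K \ J) := hK.sdiff hJo
  have hlow : ∀ w ∈ K, T w ≤ t → w ∈ K \ J := fun w hw hwt =>
    ⟨hw, fun h => by linarith [h.2]⟩
  have hcov : K ⊆ (K \ J) ∪ L := fun w hw => by
    by_cases h : w ∈ J
    · exact Or.inr ⟨hw, h.1.le, h.2.le⟩
    · exact Or.inl ⟨hw, h⟩
  have hint : ((K \ J) ∩ L).Subsingleton := by
    have key : ∀ w ∈ (K \ J) ∩ L, T w = s := by
      rintro w ⟨⟨hw, hwJ⟩, -, hwr, hws⟩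
      have hlt : dist w p < r := lt_of_le_of_ne hwr fun h => (hs w hw h).not_ge hws
      exact le_antisymm (not_lt.1 fun h => hwJ ⟨hlt, h⟩) hws
    intro a ha b hb
    refine hinj a b ?_ ((key a ha).trans (key b hb).symm)
    linarith [dist_triangle_right a b p, ha.2.2.1, hb.2.2.1]
  have main : ∀ u v : Set X, IsClosed u → IsClosed v → K \ J ⊆ u ∪ v → Disjoint u v →
      (K \ J) ∩ L ⊆ u → K \ J ⊆ u ∨ K \ J ⊆ v := by
    intro u v hu hv huv hd hsub
    rcases (isPreconnected_iff_subset_of_disjoint_closed.1 hKc) (((K \ J) ∩ u) ∪ L)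
      ((K \ J) ∩ v) ((hK'c.inter hu).union hLc) (hK'c.inter hv) (fun w hw => by
        rcases hcov hw with h | h
        · exact (huv h).imp (fun h' => Or.inl ⟨h, h'⟩) fun h' => ⟨h, h'⟩
        · exact Or.inl (Or.inr h)) (by
        refine eq_empty_of_forall_notMem ?_
        rintro w ⟨-, h1 | h1, h2⟩
        · exact disjoint_left.1 hd h1.2 h2.2
        · exact disjoint_left.1 hd (hsub ⟨h2.1, h1⟩) h2.2) with h | h
    · refine Or.inl fun w hw => ?_
      rcases h hw.1 with h' | h'
      · exact h'.2
      · exact hsub ⟨hw, h'⟩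
    · exact absurd hpJ (h hpK).1.2
  refine ⟨K \ J, ⟨sdiff_subset, fun h => (h hpK).2 hpJ⟩, hK'c, ?_, hlow⟩
  rw [isPreconnected_iff_subset_of_fully_disjoint_closed hK'c]
  intro u v hu hv huv hd
  by_cases hsub : (K \ J) ∩ L ⊆ u
  · exact main u v hu hv huv hd hsub
  · obtain ⟨w, hw, hwu⟩ := not_subset.1 hsub
    refine (main v u hv hu (by rwa [union_comm]) hd.symm fun w' hw' => ?_).symm
    rw [hint hw' hw]
    exact (huv hw.1).resolve_left hwu

/-- On a connected set a continuous locally injective real function is injective. -/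
theorem IsPreconnected.injOn_of_locally_injective {X : Type*} [MetricSpace X] [CompactSpace X]
    {T : X → ℝ} (hT : Continuous T) {δ : ℝ} (hδ : 0 < δ)
    (hinj : ∀ x y, dist x y < δ → T x = T y → x = y) {K : Set X} (hK : IsClosed K)
    (hKc : IsPreconnected K) : InjOn T K := by
  intro x hx y hy hxy
  obtain ⟨M, -, hM⟩ := zorn_superset_nonempty
    {C : Set X | IsClosed C ∧ IsPreconnected C ∧ x ∈ C ∧ y ∈ C}
    (fun c hc hch hne => ⟨⋂₀ c, ⟨isClosed_sInter fun C hC => (hc hC).1,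
      isPreconnected_sInter_of_isChain hne hch (fun C hC => (hc hC).1) fun C hC => (hc hC).2.1,
      fun C hC => (hc hC).2.2.1, fun C hC => (hc hC).2.2.2⟩,
      fun C hC => sInter_subset_of_mem hC⟩) K ⟨hK, hKc, hx, hy⟩
  obtain ⟨hMcl, hMc, hxM, hyM⟩ := hM.prop
  have hle : ∀ S : X → ℝ, Continuous S → (∀ a b, dist a b < δ → S a = S b → a = b) →
      S x = S y → ∀ z ∈ M, S z ≤ S x := by
    intro S hS hSinj hSxy z hz
    by_contra! hlt
    obtain ⟨K', hK'M, hcl, hc, hlow⟩ := exists_isPreconnected_ssubset_of_lt hS hδ hSinj hMcl hMc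
      ⟨z, hz, hlt⟩
    exact hK'M.not_subset
      (hM.le_of_le ⟨hcl, hc, hlow x hxM le_rfl, hlow y hyM hSxy.ge⟩ hK'M.subset)
  have hconst : ∀ z ∈ M, T x = T z := fun z hz => le_antisymm
    (neg_le_neg_iff.1 <| hle (fun w => -T w) hT.neg
      (fun a b hab h => hinj a b hab (neg_injective h)) (by simp [hxy]) z hz)
    (hle T hT hinj hxy z hz)
  by_cases hd : dist x y < δ
  · exact hinj x y hd hxy
  · obtain ⟨z, hz, hzd⟩ := hMc.intermediate_value hxM hyM
      (f := fun w => dist x w) (by fun_prop)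
      (show δ / 2 ∈ Icc (dist x x) (dist x y) from
        ⟨by rw [dist_self]; linarith, by linarith⟩)
    have hzd : dist x z = δ / 2 := hzd
    have := hinj x z (by linarith) (hconst z hz)
    rw [← this, dist_self] at hzd
    linarith

theorem exists_isClopen_connectedComponent_subset {X : Type*} [TopologicalSpace X] [T2Space X]
    [CompactSpace X] {x : X} {U : Set X} (hU : IsOpen U) (hxU : connectedComponent x ⊆ U) :
    ∃ V, IsClopen V ∧ x ∈ V ∧ V ⊆ U := by
  have : Nonempty {s : Set X // IsClopen s ∧ x ∈ s} := ⟨⟨univ, isClopen_univ, mem_univ x⟩⟩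
  rw [connectedComponent_eq_iInter_isClopen] at hxU
  obtain ⟨⟨V, hV, hxV⟩, hVU⟩ := exists_subset_nhds_of_isCompact
    (V := fun s : {s : Set X // IsClopen s ∧ x ∈ s} => (s : Set X))
    (fun a b => ⟨⟨a ∩ b, a.2.1.inter b.2.1, a.2.2, b.2.2⟩, inter_subset_left,
      inter_subset_right⟩)
    (fun s => s.2.1.isClosed.isCompact) fun z hz => hU.mem_nhds (hxU hz)
  exact ⟨V, hV, hxV, hVU⟩

theorem exists_continuous_injOn_union_of_isClopen {X : Type*} [TopologicalSpace X]
    {A B : Set X} (hA : IsClopen A) {f g : X → ℝ} (hf : Continuous f)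
    (hg : Continuous g) (hfA : InjOn f A) (hgB : InjOn g B) :
    ∃ e : X → ℝ, Continuous e ∧ InjOn e (A ∪ B) := by
  classical
  have key : ∀ a b, Real.arctan a ≠ Real.arctan b + 2 * Real.pi := fun a b h => by
    linarith [Real.arctan_lt_pi_div_two a, Real.neg_pi_div_two_lt_arctan b, Real.pi_pos]
  refine ⟨A.piecewise (fun x => Real.arctan (f x)) fun x => Real.arctan (g x) + 2 * Real.pi,
    Continuous.piecewise (by simp [hA.frontier_eq]) (by fun_prop) (by fun_prop), ?_⟩
  intro x hx y hy hxy
  by_cases hxA : x ∈ A <;> by_cases hyA : y ∈ A <;>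
    simp only [hxA, hyA, piecewise_eq_of_mem, piecewise_eq_of_notMem, not_false_eq_true] at hxy
  · exact hfA hxA hyA (Real.arctan_injective hxy)
  · exact absurd hxy (key _ _)
  · exact absurd hxy.symm (key _ _)
  · exact hgB (hx.resolve_left hxA) (hy.resolve_left hyA)
      (Real.arctan_injective (add_right_cancel hxy))

/-- A compact metric space admits a continuous locally injective map to `ℝ`
iff it embeds topologically into `ℝ`. -/
theorem stmt6 {l : Type*} [MetricSpace l] [CompactSpace l] :
    (∃ T : l → ℝ, Continuous T ∧ ∃ δ > (0 : ℝ), ∀ x y : l,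
        0 < dist x y → dist x y < δ → T x ≠ T y) ↔
      ∃ e : l → ℝ, Topology.IsEmbedding e := by
  constructor
  · rintro ⟨T, hT, δ, hδ, h⟩
    have hinj : ∀ x y, dist x y < δ → T x = T y → x = y := fun x y hd hxy => by
      by_contra hne
      exact h x y (dist_pos.2 hne) hd hxy
    obtain ⟨A, -, hA, e, he, heA⟩ : ∃ A : Set l, IsClopen A ∧ univ ⊆ A ∧
        ∃ e : l → ℝ, Continuous e ∧ InjOn e A := by
      refine isCompact_univ.induction_on
        (p := fun s => ∃ A : Set l, IsClopen A ∧ s ⊆ A ∧ ∃ e : l → ℝ, Continuous e ∧ InjOn e A)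
        ⟨∅, isClopen_empty, Subset.rfl, T, hT, injOn_empty T⟩ ?_ ?_ ?_
      · rintro s t hst ⟨A, hA, htA, he⟩
        exact ⟨A, hA, hst.trans htA, he⟩
      · rintro s t ⟨A, hA, hsA, f, hf, hfA⟩ ⟨B, hB, htB, g, hg, hgB⟩
        exact ⟨A ∪ B, hA.union hB, union_subset_union hsA htB,
          exists_continuous_injOn_union_of_isClopen hA hf hg hfA hgB⟩
      · intro x _
        have hK := isPreconnected_connectedComponent.injOn_of_locally_injective hT hδ hinj
          (isClosed_connectedComponent (x := x))
        have hKc : IsCompact (connectedComponent x) := isClosed_connectedComponent.isCompact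
        have hWo : IsOpen {p : l × l | T p.1 ≠ T p.2 ∨ dist p.1 p.2 < δ} :=
          (isOpen_ne_fun (hT.comp continuous_fst) (hT.comp continuous_snd)).union
            (isOpen_lt continuous_dist continuous_const)
        obtain ⟨U, V, hU, hV, hKU, hKV, hUV⟩ := generalized_tube_lemma hKc hKc hWo <| by
          rintro ⟨a, b⟩ ⟨ha, hb⟩
          by_cases hab : T a = T b
          · exact Or.inr (by rw [hK ha hb hab, dist_self]; exact hδ)
          · exact Or.inl hab
        obtain ⟨A, hA, hxA, hAUV⟩ := exists_isClopen_connectedComponent_subset (hU.inter hV)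
          (subset_inter hKU hKV)
        refine ⟨A, mem_nhdsWithin_of_mem_nhds (hA.isOpen.mem_nhds hxA), A, hA, Subset.rfl, T, hT,
          fun a ha b hb hab => hinj a b ?_ hab⟩
        exact (hUV (mk_mem_prod (hAUV ha).1 (hAUV hb).2)).resolve_left (not_not.2 hab)
    exact ⟨e, (he.isClosedEmbedding fun a b hab =>
      heA (hA (mem_univ a)) (hA (mem_univ b)) hab).isEmbedding⟩
  · rintro ⟨e, he⟩
    exact ⟨e, he.continuous, 1, one_pos, fun x y hxy _ h =>
      (dist_pos.1 hxy) (he.injective h)⟩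
end

section
/- Let φ be a kinematic expansive continuous flow on a compact metric space X. If γ_n is a sequence of periodic orbits of φ converging in the Hausdorff distance to a periodic orbit γ, then the minimal periods of the γ_n converge to the minimal period of γ. -/
open Metric Set Filter Topology

/-- A continuous flow on a metric space. -/
def IsFlow {X : Type*} [MetricSpace X] (φ : ℝ → X → X) : Prop :=
  Continuous (fun p : ℝ × X => φ p.1 p.2) ∧ (∀ x, φ 0 x = x) ∧
    ∀ s t x, φ s (φ t x) = φ (s + t) x

/-- Kinematic expansiveness. -/
def KinematicExpansive {X : Type*} [MetricSpace X] (φ : ℝ → X → X) : Prop :=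
  ∀ ε > (0 : ℝ), ∃ δ > (0 : ℝ), ∀ x y : X,
    (∀ t : ℝ, dist (φ t x) (φ t y) < δ) → ∃ s : ℝ, |s| < ε ∧ y = φ s x

/-- `γ` is a periodic orbit of `φ` with minimal period `T`. -/
def IsPeriodicOrbitWithPeriod {X : Type*} [MetricSpace X] (φ : ℝ → X → X)
    (γ : Set X) (T : ℝ) : Prop :=
  ∃ x : X, (¬ ∀ t : ℝ, φ t x = x) ∧ γ = Set.range (fun t => φ t x) ∧
    0 < T ∧ φ T x = x ∧ ∀ T' : ℝ, 0 < T' → φ T' x = x → T ≤ T'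

/-- On a compact space, the time-`τ` maps of a flow are uniformly equicontinuous for `τ ∈ [0, T]`. -/
theorem IsFlow.equicontinuous_Icc {X : Type*} [MetricSpace X] [CompactSpace X]
    {φ : ℝ → X → X} (hφ : IsFlow φ) (T : ℝ) {δ : ℝ} (hδ : 0 < δ) :
    ∃ η > 0, ∀ a b : X, dist a b < η → ∀ τ ∈ Icc 0 T, dist (φ τ a) (φ τ b) < δ := by
  have hu := (isCompact_Icc (a := (0 : ℝ)) (b := T)).prod (isCompact_univ (X := X))
    |>.uniformContinuousOn_of_continuous hφ.1.continuousOn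
  obtain ⟨η, hη, h⟩ := Metric.uniformContinuousOn_iff.1 hu δ hδ
  refine ⟨η, hη, fun a b hab τ hτ => h (τ, a) ⟨hτ, mem_univ _⟩ (τ, b) ⟨hτ, mem_univ _⟩ ?_⟩
  simpa [Prod.dist_eq, hη] using hab

theorem IsFlow.apply_nat_mul_eq {X : Type*} [MetricSpace X] {φ : ℝ → X → X} (hφ : IsFlow φ)
    {x : X} {T : ℝ} (h : φ T x = x) (m : ℕ) : φ (m * T) x = x := by
  induction m with
  | zero => simpa using hφ.2.1 x
  | succ k ih => rw [Nat.cast_succ, add_mul, one_mul, ← hφ.2.2, h, ih]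

/-- A positive number below `T - ε` has a positive multiple in `[ε, T - ε]`, if `3 * ε ≤ T`. -/
theorem exists_nat_mul_mem_Icc {S T ε : ℝ} (hS : 0 < S) (hε : 0 < ε) (hεT : 3 * ε ≤ T)
    (hST : S ≤ T - ε) : ∃ m : ℕ, m * S ∈ Icc ε (T - ε) := by
  rcases le_total ε S with h | h
  · exact ⟨1, by simpa using ⟨h, hST⟩⟩
  · refine ⟨⌈ε / S⌉₊, (div_le_iff₀ hS).1 (Nat.le_ceil _), ?_⟩
    have h1 := mul_lt_mul_of_pos_right (Nat.ceil_lt_add_one (div_pos hε hS).le) hS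
    rw [add_mul, div_mul_cancel₀ _ hS.ne'] at h1
    linarith

/-- If `φ T` fixes every point of `γ`, then a periodic orbit close enough to `γ` has minimal period
less than `T + ε`. -/
theorem KinematicExpansive.exists_period_lt {X : Type*} [MetricSpace X] [CompactSpace X]
    {φ : ℝ → X → X} (hφ : IsFlow φ) (hke : KinematicExpansive φ) {γ : Set X} {T ε : ℝ}
    (hT : 0 < T) (hγ : ∀ p ∈ γ, φ T p = p) (hε : 0 < ε) :
    ∃ η > 0, ∀ (γ' : Set X) (S : ℝ), IsPeriodicOrbitWithPeriod φ γ' S →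
      (∀ z ∈ γ', ∃ p ∈ γ, dist z p < η) → S < T + ε := by
  obtain ⟨δ, hδ, H⟩ := hke (min ε T) (lt_min hε hT)
  obtain ⟨η, hη, hη'⟩ := hφ.equicontinuous_Icc T (half_pos hδ)
  refine ⟨min η (δ / 2), lt_min hη (half_pos hδ), fun γ' S hS hclose => ?_⟩
  obtain ⟨y, -, rfl, -, -, hmin⟩ := hS
  obtain ⟨s, hs, hsy⟩ := H y (φ T y) fun t => by
    obtain ⟨p, hp, hzp⟩ := hclose (φ t y) ⟨t, rfl⟩
    have h1 := hη' _ _ (hzp.trans_le (min_le_left _ _)) T ⟨hT.le, le_rfl⟩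
    rw [hγ p hp, hφ.2.2, add_comm T t, ← hφ.2.2] at h1
    have h2 := hzp.trans_le (min_le_right _ _)
    have h3 := dist_triangle_right (φ t y) (φ t (φ T y)) p
    linarith
  obtain ⟨hs1, hs2⟩ := abs_lt.1 hs
  have h4 : φ (T - s) y = y := by
    rw [sub_eq_neg_add, ← hφ.2.2, hsy, hφ.2.2, neg_add_cancel, hφ.2.1]
  have h5 := hmin (T - s) (by linarith [min_le_right ε T]) h4
  linarith [min_le_left ε T]

/-- Lower semicontinuity of the minimal period at a point of minimal period `T`. -/
theorem IsFlow.exists_lt_period {X : Type*} [MetricSpace X] [CompactSpace X]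
    {φ : ℝ → X → X} (hφ : IsFlow φ) {x : X} {T ε : ℝ} (hε : 0 < ε) (hεT : 3 * ε ≤ T)
    (hmin : ∀ T' : ℝ, 0 < T' → φ T' x = x → T ≤ T') :
    ∃ η > 0, ∀ (y : X) (S : ℝ), dist y x < η → 0 < S → φ S y = y → T - ε < S := by
  have hcont : Continuous fun τ => dist (φ τ x) x :=
    (hφ.1.comp (Continuous.prodMk_left x)).dist continuous_const
  obtain ⟨τ₀, hτ₀, hle⟩ := (isCompact_Icc (a := ε) (b := T - ε)).exists_isMinOn
    ⟨ε, le_rfl, by linarith⟩ hcont.continuousOn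
  have hc : 0 < dist (φ τ₀ x) x := dist_pos.2 fun h => by
    linarith [hmin τ₀ (hε.trans_le hτ₀.1) h, hτ₀.2]
  obtain ⟨η, hη, hη'⟩ := hφ.equicontinuous_Icc T (half_pos hc)
  refine ⟨min η (dist (φ τ₀ x) x / 2), lt_min hη (half_pos hc), fun y S hyx hS hper => ?_⟩
  by_contra! hlt
  obtain ⟨m, hm⟩ := exists_nat_mul_mem_Icc hS hε hεT hlt
  have h1 := hη' _ _ (hyx.trans_le (min_le_left _ _)) (m * S)
    ⟨hε.le.trans hm.1, hm.2.trans (by linarith)⟩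
  rw [hφ.apply_nat_mul_eq hper] at h1
  have h2 := hyx.trans_le (min_le_right _ _)
  have h3 : dist (φ τ₀ x) x ≤ dist (φ (m * S) x) x := hle hm
  have h4 := dist_triangle_left (φ (m * S) x) x y
  linarith

/-- For a kinematic expansive flow, if periodic orbits `γ n` converge in the
Hausdorff distance to a periodic orbit `γ`, then their minimal periods converge
to the minimal period of `γ`. -/
theorem stmt7 {X : Type*} [MetricSpace X] [CompactSpace X]
    (φ : ℝ → X → X) (hφ : IsFlow φ) (hke : KinematicExpansive φ)
    (γn : ℕ → Set X) (γ : Set X) (Tn : ℕ → ℝ) (T : ℝ)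
    (h1 : ∀ n, IsPeriodicOrbitWithPeriod φ (γn n) (Tn n))
    (h2 : IsPeriodicOrbitWithPeriod φ γ T)
    (hconv : Filter.Tendsto (fun n => Metric.hausdorffDist (γn n) γ)
      Filter.atTop (nhds 0)) :
    Filter.Tendsto Tn Filter.atTop (nhds T) := by
  obtain ⟨x, -, rfl, hT, hTx, hmin⟩ := h2
  have hfin : ∀ n, hausdorffEDist (γn n) (range fun t => φ t x) ≠ ⊤ := fun n => by
    obtain ⟨y, -, hy, -⟩ := h1 n
    exact hausdorffEDist_ne_top_of_nonempty_of_bounded (hy ▸ range_nonempty _) (range_nonempty _)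
      (isCompact_univ.isBounded.subset (subset_univ _))
      (isCompact_univ.isBounded.subset (subset_univ _))
  have hγ : ∀ p ∈ range (fun t => φ t x), φ T p = p := by
    rintro _ ⟨t, rfl⟩
    simp only [hφ.2.2]
    rw [add_comm, ← hφ.2.2, hTx]
  refine tendsto_order.2 ⟨fun a ha => ?_, fun b hb => ?_⟩
  · obtain ⟨η, hη, H⟩ := hφ.exists_lt_period (ε := min (T - a) (T / 3))
      (lt_min (by linarith) (by linarith)) (by linarith [min_le_right (T - a) (T / 3)]) hmin
    filter_upwards [hconv.eventually_lt_const hη] with n hn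
    obtain ⟨z, hz, hzx⟩ := exists_dist_lt_of_hausdorffDist_lt' (mem_range.2 ⟨0, hφ.2.1 x⟩) hn (hfin n)
    obtain ⟨y, -, hy, hpos, hper, -⟩ := h1 n
    obtain ⟨t, rfl⟩ := hy ▸ hz
    have := H (φ t y) (Tn n) hzx hpos (by rw [hφ.2.2, add_comm, ← hφ.2.2, hper])
    linarith [min_le_left (T - a) (T / 3)]
  · obtain ⟨η, hη, H⟩ := hke.exists_period_lt hφ hT hγ (sub_pos.2 hb)
    filter_upwards [hconv.eventually_lt_const hη] with n hn
    have := H (γn n) (Tn n) (h1 n) fun z hz => exists_dist_lt_of_hausdorffDist_lt hz hn (hfin n)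
    linarith
end

section
/- Let I = [0,1] and let f : I → I be a homeomorphism. There exists a continuous map T : I → (0,∞) such that the suspension pair (f,T) is kinematic expansive if and only if the set of periodic points of f has finitely many connected components and the minimal-period function is continuous on the set of periodic points (equivalently, in the orientation-reversing case, the fixed point of f is not accumulated by points of period 2). -/
open Metric Set Filter Topology

/-- Birkhoff sums of the return time `T` along the `ℤ`-orbit of `f`:
`S n x = Σ_{i=0}^{n-1} T(f^i x)` for `n ≥ 0` and
`S n x = -Σ_{i=n}^{-1} T(f^i x)` for `n < 0`. -/
noncomputable def suspSum {Y : Type*} (f : Equiv.Perm Y) (T : Y → ℝ)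
    (n : ℤ) (x : Y) : ℝ :=
  if 0 ≤ n then ∑ i ∈ Finset.range n.toNat, T ((f ^ (i : ℤ)) x)
  else -∑ i ∈ Finset.range (-n).toNat, T ((f ^ (-(i : ℤ) - 1)) x)

/-- The suspension pair `(f, T)` is kinematic expansive. -/
def SuspKinExpansive {Y : Type*} [MetricSpace Y] (f : Equiv.Perm Y)
    (T : Y → ℝ) : Prop :=
  ∃ ρ > (0 : ℝ), ∀ x y : Y,
    (∀ n : ℤ, dist ((f ^ n) x) ((f ^ n) y) < ρ ∧
      |suspSum f T n x - suspSum f T n y| < ρ) → x = y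

/-! ### Birkhoff sums -/

section BirkhoffSums

variable {Y : Type*} (f : Equiv.Perm Y) (T : Y → ℝ)

theorem suspSum_zero (x : Y) : suspSum f T 0 x = 0 := by simp [suspSum]

theorem suspSum_natCast (n : ℕ) (x : Y) :
    suspSum f T n x = ∑ i ∈ Finset.range n, T ((f ^ (i : ℤ)) x) := by
  simp [suspSum]

theorem suspSum_neg_natCast (n : ℕ) (x : Y) :
    suspSum f T (-(n : ℤ)) x = -∑ i ∈ Finset.range n, T ((f ^ (-(i : ℤ) - 1)) x) := by
  rcases Nat.eq_zero_or_pos n with rfl | hn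
  · simp [suspSum]
  · rw [suspSum, if_neg (by omega)]
    simp

theorem suspSum_add_one (n : ℤ) (x : Y) :
    suspSum f T (n + 1) x = suspSum f T n x + T ((f ^ n) x) := by
  obtain ⟨k, rfl | rfl⟩ := n.eq_nat_or_neg
  · have := suspSum_natCast f T (k + 1) x
    push_cast at this
    rw [this, suspSum_natCast, Finset.sum_range_succ]
  · cases k with
    | zero => simpa [suspSum_zero] using suspSum_natCast f T 1 x
    | succ k =>
      have h : (-((k + 1 : ℕ) : ℤ) + 1) = -(k : ℤ) := by push_cast; ring
      rw [h, suspSum_neg_natCast, suspSum_neg_natCast, Finset.sum_range_succ]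
      have h' : (-(k : ℤ) - 1) = -((k + 1 : ℕ) : ℤ) := by push_cast; ring
      rw [h']
      ring

/-- The recursion `suspSum_add_one` determines the Birkhoff sums. -/
theorem eq_suspSum_of_add_one {h : ℤ → ℝ} {x : Y} (h0 : h 0 = 0)
    (hs : ∀ n, h (n + 1) = h n + T ((f ^ n) x)) (n : ℤ) : h n = suspSum f T n x := by
  induction n using Int.induction_on with
  | zero => rw [h0, suspSum_zero]
  | succ n ih => rw [hs, suspSum_add_one, ih]
  | pred n ih =>
    have h1 := hs (-(n : ℤ) - 1)
    have h2 := suspSum_add_one f T (-(n : ℤ) - 1) x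
    rw [sub_add_cancel] at h1 h2
    linarith

theorem suspSum_one (x : Y) : suspSum f T 1 x = T x := by simp [suspSum]

theorem suspSum_two (x : Y) : suspSum f T 2 x = T x + T (f x) := by
  rw [← one_add_one_eq_two, suspSum_add_one, suspSum_one, zpow_one]

theorem suspSum_add (n k : ℤ) (x : Y) :
    suspSum f T (n + k) x = suspSum f T k x + suspSum f T n ((f ^ k) x) := by
  have := eq_suspSum_of_add_one f T (x := (f ^ k) x)
    (h := fun n => suspSum f T (n + k) x - suspSum f T k x) (by simp) (fun n => by
      have : n + 1 + k = n + k + 1 := by ring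
      rw [this, suspSum_add_one, ← Equiv.Perm.mul_apply, ← zpow_add]
      ring) n
  linarith

/-- Shifting the base point along its orbit changes the Birkhoff sums by a coboundary. -/
theorem suspSum_zpow_apply_sub (n k : ℤ) (x : Y) :
    suspSum f T n ((f ^ k) x) - suspSum f T n x =
      suspSum f T k ((f ^ n) x) - suspSum f T k x := by
  have h1 := suspSum_add f T n k x
  have h2 := suspSum_add f T k n x
  rw [add_comm] at h2
  linarith

theorem abs_suspSum_le {B : ℝ} (hB : ∀ x, |T x| ≤ B) (k : ℤ) (x : Y) :
    |suspSum f T k x| ≤ |(k : ℝ)| * B := by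
  obtain ⟨n, rfl | rfl⟩ := k.eq_nat_or_neg
  · rw [suspSum_natCast]
    refine (Finset.abs_sum_le_sum_abs _ _).trans ((Finset.sum_le_sum fun i _ => hB _).trans ?_)
    simp
  · rw [suspSum_neg_natCast, abs_neg]
    refine (Finset.abs_sum_le_sum_abs _ _).trans ((Finset.sum_le_sum fun i _ => hB _).trans ?_)
    simp

/-- The Birkhoff sums of `x` and `y` are not at bounded distance from each other. -/
def SuspUnbounded (x y : Y) : Prop :=
  ∀ B : ℝ, ∃ n : ℤ, B < |suspSum f T n x - suspSum f T n y|

variable {f T}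

theorem SuspUnbounded.of_zpow_apply {B : ℝ} (hB : ∀ x, |T x| ≤ B) {x y : Y} {k l : ℤ}
    (h : SuspUnbounded f T ((f ^ k) x) ((f ^ l) y)) : SuspUnbounded f T x y := by
  intro C
  obtain ⟨n, hn⟩ := h (C + 2 * (|(k : ℝ)| * B) + 2 * (|(l : ℝ)| * B))
  refine ⟨n, ?_⟩
  have hx := suspSum_zpow_apply_sub f T n k x
  have hy := suspSum_zpow_apply_sub f T n l y
  have h1 := abs_le.1 (abs_suspSum_le f T hB k x)
  have h2 := abs_le.1 (abs_suspSum_le f T hB k ((f ^ n) x))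
  have h3 := abs_le.1 (abs_suspSum_le f T hB l y)
  have h4 := abs_le.1 (abs_suspSum_le f T hB l ((f ^ n) y))
  rcases lt_abs.1 hn with hn | hn
  · exact lt_abs.2 (Or.inl (by linarith))
  · exact lt_abs.2 (Or.inr (by linarith))

end BirkhoffSums

/-! ### Increasing permutations of the interval -/

/-- The closed unit interval. -/
abbrev UI : Type := ↥(Set.Icc (0 : ℝ) 1)

theorem strictMono_perm_inv {X : Type*} [LinearOrder X] {g : Equiv.Perm X} (hg : StrictMono g) :
    StrictMono (g⁻¹ : Equiv.Perm X) := fun x y hxy => by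
  rw [← hg.lt_iff_lt]
  simpa using hxy

theorem strictMono_perm_zpow {X : Type*} [LinearOrder X] {g : Equiv.Perm X} (hg : StrictMono g)
    (n : ℤ) : StrictMono (g ^ n : Equiv.Perm X) := by
  induction n using Int.induction_on with
  | zero => simpa using strictMono_id
  | succ n ih =>
    rw [zpow_add_one, Equiv.Perm.coe_mul]
    exact ih.comp hg
  | pred n ih =>
    rw [zpow_sub_one, Equiv.Perm.coe_mul]
    exact ih.comp (strictMono_perm_inv hg)

theorem zpow_apply_eq_self {X : Type*} {g : Equiv.Perm X} {x : X} (hx : g x = x) (n : ℤ) :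
    (g ^ n) x = x := (show Function.IsFixedPt g x from hx).perm_zpow n

theorem zpow_add_one_apply {X : Type*} (g : Equiv.Perm X) (n : ℤ) (x : X) :
    (g ^ (n + 1)) x = g ((g ^ n) x) := by
  rw [add_comm, zpow_one_add, Equiv.Perm.mul_apply]

theorem continuous_perm_of_strictMono {g : Equiv.Perm UI} (hg : StrictMono g) : Continuous g :=
  (StrictMono.orderIsoOfSurjective g hg g.surjective).continuous

/-- The supremum of an orbit of an increasing permutation is a fixed point. -/
theorem apply_sSup_orbit {g : Equiv.Perm UI} (hg : StrictMono g) (x : UI) :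
    g (sSup (Set.range fun n : ℤ => (g ^ n) x)) = sSup (Set.range fun n : ℤ => (g ^ n) x) := by
  have hlub := isLUB_sSup (Set.range fun n : ℤ => (g ^ n) x)
  set p := sSup (Set.range fun n : ℤ => (g ^ n) x)
  refine le_antisymm ?_ (hlub.2 ?_)
  · have : p ≤ g⁻¹ p := hlub.2 (by
      rintro _ ⟨n, rfl⟩
      rw [← hg.le_iff_le]
      simpa [zpow_add_one_apply] using hlub.1 ⟨n + 1, rfl⟩)
    simpa using hg.monotone this
  · rintro _ ⟨n, rfl⟩
    have := hg.monotone (hlub.1 ⟨n - 1, rfl⟩)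
    simpa [← zpow_add_one_apply] using this

/-- The infimum of an orbit of an increasing permutation is a fixed point. -/
theorem apply_sInf_orbit {g : Equiv.Perm UI} (hg : StrictMono g) (x : UI) :
    g (sInf (Set.range fun n : ℤ => (g ^ n) x)) = sInf (Set.range fun n : ℤ => (g ^ n) x) := by
  have hglb := isGLB_sInf (Set.range fun n : ℤ => (g ^ n) x)
  set p := sInf (Set.range fun n : ℤ => (g ^ n) x)
  refine le_antisymm (hglb.2 ?_) ?_
  · rintro _ ⟨n, rfl⟩
    have := hg.monotone (hglb.1 ⟨n - 1, rfl⟩)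
    simpa [← zpow_add_one_apply] using this
  · have : g⁻¹ p ≤ p := hglb.2 (by
      rintro _ ⟨n, rfl⟩
      rw [← hg.le_iff_le]
      simpa [zpow_add_one_apply] using hglb.1 ⟨n + 1, rfl⟩)
    simpa using hg.monotone this

/-- An orbit passes every point that no fixed point separates from it. -/
theorem exists_lt_zpow_apply {g : Equiv.Perm UI} (hg : StrictMono g) {x q : UI}
    (h : ∀ z ∈ Set.Icc x q, g z ≠ z) : ∃ n : ℤ, q < (g ^ n) x := by
  by_contra! hn
  refine h _ ⟨?_, ?_⟩ (apply_sSup_orbit hg x)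
  · exact le_sSup ⟨0, by simp⟩
  · exact sSup_le (by rintro _ ⟨n, rfl⟩; exact hn n)

theorem exists_zpow_apply_lt {g : Equiv.Perm UI} (hg : StrictMono g) {x q : UI}
    (h : ∀ z ∈ Set.Icc q x, g z ≠ z) : ∃ n : ℤ, (g ^ n) x < q := by
  by_contra! hn
  refine h _ ⟨?_, ?_⟩ (apply_sInf_orbit hg x)
  · exact le_sInf (by rintro _ ⟨n, rfl⟩; exact hn n)
  · exact sInf_le ⟨0, by simp⟩

theorem strictMono_zpow_apply {g : Equiv.Perm UI} (hg : StrictMono g) {m : UI} (hm : m < g m) :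
    StrictMono fun n : ℤ => (g ^ n) m := by
  refine strictMono_int_of_lt_succ fun n => ?_
  rw [zpow_add_one, Equiv.Perm.mul_apply]
  exact strictMono_perm_zpow hg n hm

/-! ### Gaps of the fixed point set -/

/-- `x` and `y` lie in the same component of the complement of the fixed point set of `g`. -/
def SameGap (g : Equiv.Perm UI) (x y : UI) : Prop := ∀ z ∈ Set.uIcc x y, g z ≠ z

theorem SameGap.symm {g : Equiv.Perm UI} {x y : UI} (h : SameGap g x y) : SameGap g y x := by
  rwa [SameGap, Set.uIcc_comm]

theorem SameGap.trans {g : Equiv.Perm UI} {x y z : UI} (h : SameGap g x y) (h' : SameGap g y z) :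
    SameGap g x z := fun w hw =>
  (Set.uIcc_subset_uIcc_union_uIcc hw).elim (h w) (h' w)

theorem SameGap.refl {g : Equiv.Perm UI} {x : UI} (h : g x ≠ x) : SameGap g x x := by
  intro z hz
  rw [Set.uIcc_self, Set.mem_singleton_iff] at hz
  rwa [hz]

theorem SameGap.ne_left {g : Equiv.Perm UI} {x y : UI} (h : SameGap g x y) : g x ≠ x :=
  h x Set.left_mem_uIcc

theorem sameGap_inv {g : Equiv.Perm UI} {x y : UI} : SameGap g⁻¹ x y ↔ SameGap g x y := by
  refine forall₂_congr fun z _ => not_congr ?_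
  rw [Equiv.Perm.inv_eq_iff_eq, eq_comm]

theorem sameGap_zpow_apply {g : Equiv.Perm UI} (hg : StrictMono g) {x : UI} (hx : g x ≠ x)
    (n : ℤ) : SameGap g x ((g ^ n) x) := by
  intro z hz hgz
  have key : ∀ a b : UI, a ≤ z → z ≤ b → ∀ k : ℤ, (g ^ k) a = b ∨ (g ^ k) b = a → a = z := by
    intro a b ha hb k hk
    rcases hk with hk | hk
    · have := (strictMono_perm_zpow hg k).monotone ha
      rw [zpow_apply_eq_self hgz, hk] at this
      have hbz : b = z := le_antisymm this hb
      rw [hbz] at hk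
      exact (g ^ k).injective (hk.trans (zpow_apply_eq_self hgz k).symm)
    · have := (strictMono_perm_zpow hg k).monotone hb
      rw [zpow_apply_eq_self hgz, hk] at this
      exact le_antisymm ha this
  have hne : ∀ w, (g ^ n) x = w → w ≠ z := by
    rintro w h rfl
    rw [← zpow_apply_eq_self hgz n] at h
    exact hx ((g ^ n).injective h ▸ hgz)
  rcases Set.mem_uIcc.1 hz with ⟨h1, h2⟩ | ⟨h1, h2⟩
  · exact hx (key _ _ h1 h2 n (Or.inl rfl) ▸ hgz)
  · exact hne _ rfl (key _ _ h1 h2 n (Or.inr rfl))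

/-- A fundamental domain `D` for `g` on the gap containing `m`, with two continuous functions
vanishing off `D` which together separate the points of `D`, and a separation constant `c`. -/
structure GapDomain (g : Equiv.Perm UI) (m : UI) where
  D : Set UI
  φ : UI → ℝ
  ψ : UI → ℝ
  c : ℝ
  continuous_φ : Continuous φ
  continuous_ψ : Continuous ψ
  φ_eq_zero : ∀ x ∉ D, φ x = 0
  ψ_eq_zero : ∀ x ∉ D, ψ x = 0
  wandering : ∀ x ∈ D, ∀ k : ℤ, k ≠ 0 → (g ^ k) x ∉ D
  sameGap : ∀ x ∈ D, SameGap g x m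
  covering : ∀ x, SameGap g x m → ∃ n : ℤ, (g ^ n) x ∈ D
  separating : ∀ x ∈ D, ∀ y ∈ D, φ x = φ y → ψ x = ψ y → x = y
  c_pos : 0 < c
  le_dist_fixed : ∀ x ∈ D, ∀ p, g p = p → c ≤ dist x p
  le_dist_zpow : ∀ x ∈ D, ∀ k : ℤ, k ≠ 0 → c ≤ dist x ((g ^ k) x)

/-- A gap domain for `g⁻¹` is one for `g`. -/
def GapDomain.ofInv {g : Equiv.Perm UI} {m : UI} (d : GapDomain g⁻¹ m) : GapDomain g m where
  D := d.D
  φ := d.φ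
  ψ := d.ψ
  c := d.c
  continuous_φ := d.continuous_φ
  continuous_ψ := d.continuous_ψ
  φ_eq_zero := d.φ_eq_zero
  ψ_eq_zero := d.ψ_eq_zero
  wandering x hx k hk := by
    simpa using d.wandering x hx (-k) (neg_ne_zero.2 hk)
  sameGap x hx := sameGap_inv.1 (d.sameGap x hx)
  covering x hx := by
    obtain ⟨n, hn⟩ := d.covering x (sameGap_inv.2 hx)
    exact ⟨-n, by simpa using hn⟩
  separating := d.separating
  c_pos := d.c_pos
  le_dist_fixed x hx p hp := d.le_dist_fixed x hx p (by rw [Equiv.Perm.inv_eq_iff_eq, hp])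
  le_dist_zpow x hx k hk := by
    simpa using d.le_dist_zpow x hx (-k) (neg_ne_zero.2 hk)

theorem gapDomain_nonempty_of_lt {g : Equiv.Perm UI} (hg : StrictMono g) {m : UI}
    (hm : m < g m) : Nonempty (GapDomain g m) := by
  have hcont := continuous_perm_of_strictMono hg
  have hcont' := continuous_perm_of_strictMono (strictMono_perm_inv hg)
  have hfix : ∀ z ∈ Set.Icc m (g m), g z ≠ z := fun z hz hgz => by
    have h1 : g m ≤ g z := hg.monotone hz.1
    have h2 : z = g m := le_antisymm hz.2 (hgz ▸ h1)
    exact hm.ne' (g.injective (h2 ▸ hgz))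
  have hup : ∀ z ∈ Set.Icc m (g m), z < g z := fun z hz =>
    lt_of_le_of_ne (hz.2.trans (hg.monotone hz.1)) (hfix z hz).symm
  have hgap : ∀ x ∈ Set.Ico m (g m), SameGap g x m := fun x hx z hz => by
    rw [Set.uIcc_of_ge hx.1] at hz
    exact hfix z ⟨hz.1, hz.2.trans hx.2.le⟩
  obtain ⟨c₁, hc₁, hc₁'⟩ : ∃ c : ℝ, 0 < c ∧ ∀ z ∈ Set.Icc m (g m),
      c ≤ min (dist z (g z)) (dist z (g⁻¹ z)) := by
    obtain ⟨w, hw, hmin⟩ := (isCompact_Icc (a := m) (b := g m)).exists_isMinOn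
      ⟨m, le_rfl, hm.le⟩ (f := fun z => min (dist z (g z)) (dist z (g⁻¹ z)))
      ((continuous_id.dist hcont).min (continuous_id.dist hcont')).continuousOn
    refine ⟨_, lt_min (dist_pos.2 (hfix w hw).symm) (dist_pos.2 fun h => hfix w hw ?_),
      fun z hz => hmin hz⟩
    rw [eq_comm, Equiv.Perm.inv_eq_iff_eq] at h
    exact h.symm
  obtain ⟨c₂, hc₂, hc₂'⟩ := Metric.exists_pos_forall_lt_edist (isCompact_Icc (a := m) (b := g m))
    (isClosed_eq hcont continuous_id) (Set.disjoint_left.2 hfix)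
  refine ⟨{
    D := Set.Ico m (g m)
    φ := fun z => max 0 ((z.1 - m.1) * ((g m).1 - z.1))
    ψ := fun z => max 0 ((z.1 - m.1) * ((g m).1 - z.1)) * (z.1 - m.1)
    c := min c₁ c₂
    continuous_φ := by fun_prop
    continuous_ψ := by fun_prop
    φ_eq_zero := ?_
    ψ_eq_zero := ?_
    wandering := ?_
    sameGap := hgap
    covering := ?_
    separating := ?_
    c_pos := lt_min hc₁ (by exact_mod_cast hc₂)
    le_dist_fixed := ?_
    le_dist_zpow := ?_ }⟩
  · intro x hx
    rcases lt_or_ge x m with h | h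
    · have h1 : x.1 < m.1 := h
      have h2 : m.1 < (g m).1 := hm
      exact max_eq_left (by nlinarith)
    · have h3 : g m ≤ x := not_lt.1 fun h' => hx ⟨h, h'⟩
      have h1 : m.1 ≤ x.1 := h
      have h2 : (g m).1 ≤ x.1 := h3
      exact max_eq_left (by nlinarith)
  · intro x hx
    rcases lt_or_ge x m with h | h
    · have h1 : x.1 < m.1 := h
      have h2 : m.1 < (g m).1 := hm
      exact mul_eq_zero_of_left (max_eq_left (by nlinarith)) _
    · have h3 : g m ≤ x := not_lt.1 fun h' => hx ⟨h, h'⟩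
      have h1 : m.1 ≤ x.1 := h
      have h2 : (g m).1 ≤ x.1 := h3
      exact mul_eq_zero_of_left (max_eq_left (by nlinarith)) _
  · intro x hx k hk hkx
    have hx' := hup x ⟨hx.1, hx.2.le⟩
    rcases lt_or_gt_of_ne hk with hk | hk
    · have h1 : (g ^ (k + 1)) x ≤ (g ^ (0 : ℤ)) x :=
        (strictMono_zpow_apply hg hx').monotone (by omega)
      rw [zpow_add_one_apply, zpow_zero, Equiv.Perm.one_apply] at h1
      exact absurd ((hg.monotone hkx.1).trans h1) (not_le.2 hx.2)
    · have h1 : (g ^ (1 : ℤ)) x ≤ (g ^ k) x :=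
        (strictMono_zpow_apply hg hx').monotone (by omega)
      rw [zpow_one] at h1
      exact absurd ((hg.monotone hx.1).trans h1) (not_le.2 hkx.2)
  · intro x hx
    have hmono := strictMono_zpow_apply hg hm
    have hlow : ∃ n : ℤ, (g ^ n) m ≤ x := by
      rcases le_total m x with h | h
      · exact ⟨0, by simpa using h⟩
      · rw [SameGap, Set.uIcc_of_le h] at hx
        exact (exists_zpow_apply_lt hg hx).imp fun n hn => hn.le
    have hhigh : ∃ n : ℤ, x < (g ^ n) m := by
      rcases le_total m x with h | h
      · rw [SameGap, Set.uIcc_of_ge h] at hx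
        exact exists_lt_zpow_apply hg hx
      · exact ⟨1, by simpa using h.trans_lt hm⟩
    obtain ⟨b, hb⟩ := hhigh
    obtain ⟨n, hn, hn'⟩ := Int.exists_greatest_of_bdd
      ⟨b, fun z hz => (hmono.lt_iff_lt.1 (lt_of_le_of_lt hz hb)).le⟩ hlow
    have hn1 : x < (g ^ (n + 1)) m := not_le.1 fun h => by
      have := hn' _ h
      omega
    refine ⟨-n, ?_, ?_⟩
    · simpa using (strictMono_perm_zpow hg (-n)).monotone hn
    · have h := strictMono_perm_zpow hg (-n) hn1
      rwa [← Equiv.Perm.mul_apply, ← zpow_add, neg_add_cancel_left, zpow_one] at h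
  · have hmax : ∀ x ∈ Set.Ico m (g m), max 0 ((x.1 - m.1) * ((g m).1 - x.1)) =
        (x.1 - m.1) * ((g m).1 - x.1) := fun x hx => by
      have h1 : m.1 ≤ x.1 := hx.1
      have h2 : x.1 < (g m).1 := hx.2
      exact max_eq_right (mul_nonneg (by linarith) (by linarith))
    intro x hx y hy h1 h2
    simp only [hmax x hx, hmax y hy] at h1 h2
    have hx2 : x.1 < (g m).1 := hx.2
    have hy2 : y.1 < (g m).1 := hy.2
    rw [← h1] at h2
    rcases mul_eq_zero.1 (show (x.1 - m.1) * ((g m).1 - x.1) * (x.1 - y.1) = 0 by linarith)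
      with h | h
    · have hxm : x.1 - m.1 = 0 := (mul_eq_zero.1 h).resolve_right (by linarith)
      rw [h] at h1
      have hym : y.1 - m.1 = 0 := (mul_eq_zero.1 h1.symm).resolve_right (by linarith)
      exact Subtype.ext (by linarith)
    · exact Subtype.ext (by linarith)
  · intro x hx p hp
    have h := hc₂' x ⟨hx.1, hx.2.le⟩ p hp
    rw [edist_nndist, ENNReal.coe_lt_coe] at h
    exact (min_le_right _ _).trans (by exact_mod_cast h.le)
  · intro x hx k hk
    have hx' := hup x ⟨hx.1, hx.2.le⟩
    have hmono := (strictMono_zpow_apply hg hx').monotone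
    have hc := hc₁' x ⟨hx.1, hx.2.le⟩
    rcases lt_or_gt_of_ne hk with hk | hk
    · refine (min_le_left _ _).trans (hc.trans ((min_le_right _ _).trans ?_))
      have h1 : (g ^ k) x ≤ g⁻¹ x := by simpa using hmono (show k ≤ -1 by omega)
      have h2 : g⁻¹ x ≤ x := by simpa using hmono (show (-1 : ℤ) ≤ 0 by omega)
      have h1' : ((g ^ k) x).1 ≤ (g⁻¹ x).1 := h1
      have h2' : (g⁻¹ x).1 ≤ x.1 := h2
      rw [Subtype.dist_eq, Subtype.dist_eq, Real.dist_eq, Real.dist_eq,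
        abs_of_nonneg (by linarith), abs_of_nonneg (by linarith)]
      linarith
    · refine (min_le_left _ _).trans (hc.trans ((min_le_left _ _).trans ?_))
      have h1 : g x ≤ (g ^ k) x := by simpa using hmono (show 1 ≤ k by omega)
      have h1' : (g x).1 ≤ ((g ^ k) x).1 := h1
      have h2' : x.1 < (g x).1 := hx'
      rw [Subtype.dist_eq, Subtype.dist_eq, Real.dist_eq, Real.dist_eq,
        abs_of_nonpos (by linarith), abs_of_nonpos (by linarith)]
      linarith

theorem gapDomain_nonempty {g : Equiv.Perm UI} (hg : StrictMono g) {m : UI} (hm : g m ≠ m) :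
    Nonempty (GapDomain g m) := by
  rcases lt_or_gt_of_ne hm with h | h
  · have h' : m < g⁻¹ m := by simpa using strictMono_perm_inv hg h
    exact (gapDomain_nonempty_of_lt (strictMono_perm_inv hg) h').map GapDomain.ofInv
  · exact gapDomain_nonempty_of_lt hg h

/-! ### Oscillating functions on a gap -/

/-- Amplitudes with divergent sums: harmonic multiples of `u` in the future and of `v` in the
past. -/
noncomputable def harmonicAmp (u v : ℝ) (k : ℤ) : ℝ :=
  if 0 ≤ k then u * (1 / ((k : ℝ) + 1)) else v * (1 / (-(k : ℝ)))

theorem abs_harmonicAmp_le {u v B : ℝ} (hu : |u| ≤ B) (hv : |v| ≤ B) {N : ℕ} (hN : 0 < N)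
    {k : ℤ} (hk : k ∉ Finset.Icc (-(N : ℤ)) N) : |harmonicAmp u v k| ≤ B / N := by
  have hN' : (0 : ℝ) < N := by exact_mod_cast hN
  have key : ∀ w r : ℝ, |w| ≤ B → (N : ℝ) ≤ r → |w * (1 / r)| ≤ B / N := fun w r hw hr => by
    rw [mul_one_div, abs_div, abs_of_pos (hN'.trans_le hr)]
    exact div_le_div₀ ((abs_nonneg w).trans hw) hw hN' hr
  rw [Finset.mem_Icc, not_and_or, not_le, not_le] at hk
  rw [harmonicAmp]
  split_ifs with h
  · refine key _ _ hu ?_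
    have : (N : ℤ) ≤ k + 1 := by omega
    exact_mod_cast this
  · refine key _ _ hv ?_
    have : (N : ℤ) ≤ -k := by omega
    exact_mod_cast this

theorem GapDomain.exists_oscillation {g : Equiv.Perm UI} (hg : StrictMono g) {m : UI}
    (d : GapDomain g m) : ∃ O : UI → ℝ, Continuous O ∧
      (∀ x ∈ d.D, ∀ k : ℤ, O ((g ^ k) x) = harmonicAmp (d.φ x) (d.ψ x) k) ∧
      ∀ z, (∀ k : ℤ, (g ^ k) z ∉ d.D) → O z = 0 := by
  set F : ℤ → UI → ℝ := fun k z => harmonicAmp (d.φ ((g ^ (-k)) z)) (d.ψ ((g ^ (-k)) z)) k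
    with hF
  have hcont : ∀ k, Continuous (F k) := fun k => by
    have h1 := continuous_perm_of_strictMono (strictMono_perm_zpow hg (-k))
    have h2 := d.continuous_φ.comp h1
    have h3 := d.continuous_ψ.comp h1
    simp only [hF, harmonicAmp]
    split_ifs
    · exact h2.mul continuous_const
    · exact h3.mul continuous_const
  have hzero : ∀ k z, (g ^ (-k)) z ∉ d.D → F k z = 0 := fun k z hz => by
    simp only [hF, d.φ_eq_zero _ hz, d.ψ_eq_zero _ hz, harmonicAmp]
    simp
  have huniq : ∀ z k l, (g ^ (-k)) z ∈ d.D → l ≠ k → F l z = 0 := fun z k l hk hl => by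
    refine hzero l z fun h => d.wandering _ hk (-l + k) (by omega) ?_
    rwa [← Equiv.Perm.mul_apply, ← zpow_add, add_neg_cancel_right]
  obtain ⟨B₁, hB₁⟩ := isCompact_univ.exists_bound_of_continuousOn d.continuous_φ.continuousOn
  obtain ⟨B₂, hB₂⟩ := isCompact_univ.exists_bound_of_continuousOn d.continuous_ψ.continuousOn
  have hsum : ∀ z k, (g ^ (-k)) z ∈ d.D → ∑' l, F l z = F k z := fun z k hk =>
    tsum_eq_single k fun l hl => huniq z k l hk hl
  have hsum0 : ∀ z, (∀ k : ℤ, (g ^ (-k)) z ∉ d.D) → ∀ k, F k z = 0 := fun z hz k =>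
    hzero k z (hz k)
  refine ⟨fun z => ∑' k, F k z, ?_, ?_, ?_⟩
  · have hunif : TendstoUniformly (fun (s : Finset ℤ) z => ∑ k ∈ s, F k z)
        (fun z => ∑' k, F k z) atTop := by
      rw [Metric.tendstoUniformly_iff]
      intro ε hε
      set B := max B₁ B₂
      obtain ⟨N, hN⟩ := exists_nat_gt (max (B / ε) 1)
      have hN1 : (1 : ℝ) < N := (le_max_right _ _).trans_lt hN
      have hNpos : 0 < N := by exact_mod_cast zero_lt_one.trans hN1
      have hBN : B / N < ε := by
        rw [div_lt_iff₀ (by positivity), mul_comm, ← div_lt_iff₀ hε]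
        exact (le_max_left _ _).trans_lt hN
      filter_upwards [eventually_ge_atTop (Finset.Icc (-(N : ℤ)) N)] with s hs z
      by_cases hz : ∃ k : ℤ, (g ^ (-k)) z ∈ d.D
      · obtain ⟨k, hk⟩ := hz
        rw [hsum z k hk]
        by_cases hks : k ∈ s
        · rwa [Finset.sum_eq_single_of_mem k hks fun l _ hl => huniq z k l hk hl, dist_self]
        · rw [Finset.sum_eq_zero fun l hl =>
            huniq z k l hk fun h => hks (h ▸ hl), dist_zero_right, Real.norm_eq_abs]
          exact (abs_harmonicAmp_le ((hB₁ _ trivial).trans (le_max_left _ _))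
            ((hB₂ _ trivial).trans (le_max_right _ _)) hNpos fun h => hks (hs h)).trans_lt hBN
      · push Not at hz
        simpa [hsum0 z hz] using hε
    exact hunif.continuous (Frequently.of_forall fun s => continuous_finsetSum s fun k _ => hcont k)
  · intro x hx k
    have h : (g ^ (-k)) ((g ^ k) x) = x := by simp
    exact (hsum _ k (h.symm ▸ hx)).trans (by simp only [hF, h])
  · intro z hz
    simp [hsum0 z fun k => hz (-k)]

/-- Two points of a set where `W` is a constant plus harmonic amplitudes along orbits have
unbounded relative Birkhoff sums as soon as one of the amplitudes differs. -/
theorem suspUnbounded_of_harmonicAmp {Y : Type*} {g : Equiv.Perm Y} {W : Y → ℝ} {x y : Y}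
    {c u v u' v' : ℝ} (hx : ∀ k : ℤ, W ((g ^ k) x) = c + harmonicAmp u v k)
    (hy : ∀ k : ℤ, W ((g ^ k) y) = c + harmonicAmp u' v' k) (h : u ≠ u' ∨ v ≠ v') :
    SuspUnbounded g W x y := by
  intro B
  have hpos : ∀ w : ℝ, w ≠ 0 → ∃ n : ℕ, B < |w * ∑ i ∈ Finset.range n, 1 / ((i : ℝ) + 1)| := by
    intro w hw
    have h1 := Real.tendsto_sum_range_one_div_nat_succ_atTop.const_mul_atTop (abs_pos.2 hw)
    obtain ⟨n, hn⟩ := (h1.eventually_gt_atTop B).exists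
    exact ⟨n, by rw [abs_mul]; exact hn.trans_le (by gcongr; exact le_abs_self _)⟩
  rcases h with h | h
  · obtain ⟨n, hn⟩ := hpos (u - u') (sub_ne_zero.2 h)
    refine ⟨n, hn.trans_eq (congrArg _ ?_)⟩
    rw [suspSum_natCast, suspSum_natCast, ← Finset.sum_sub_distrib, Finset.mul_sum]
    refine Finset.sum_congr rfl fun i _ => ?_
    rw [hx, hy, harmonicAmp, harmonicAmp, if_pos (by positivity), if_pos (by positivity)]
    push_cast
    ring
  · obtain ⟨n, hn⟩ := hpos (v' - v) (sub_ne_zero.2 h.symm)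
    refine ⟨-n, hn.trans_eq (congrArg _ ?_)⟩
    rw [suspSum_neg_natCast, suspSum_neg_natCast, neg_sub_neg, ← Finset.sum_sub_distrib,
      Finset.mul_sum]
    refine Finset.sum_congr rfl fun i _ => ?_
    rw [hx, hy, harmonicAmp, harmonicAmp, if_neg (by omega), if_neg (by omega)]
    push_cast
    ring

/-! ### The base function -/

/-- A continuous function which is constant on gaps and injective on intervals of fixed points. -/
theorem exists_base {g : Equiv.Perm UI} (hg : StrictMono g) : ∃ b : UI → ℝ, Continuous b ∧
    (∀ x y, SameGap g x y → b x = b y) ∧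
    ∀ x y, x < y → (∀ z ∈ Set.Icc x y, g z = z) → b x ≠ b y := by
  set K : Set ℝ := Subtype.val '' {z : UI | g z = z}
  have hK : IsClosed K := ((isClosed_eq (continuous_perm_of_strictMono hg)
    continuous_id).isCompact.image continuous_subtype_val).isClosed
  set χ : ℝ → ℝ := K.indicator 1
  have hχ : ∀ a b : ℝ, IntervalIntegrable χ MeasureTheory.volume a b := fun a b => by
    rw [intervalIntegrable_iff]
    exact (MeasureTheory.integrableOn_const (by simp)).indicator hK.measurableSet
  have hdiff : ∀ x y : UI, (∫ t in (0 : ℝ)..y, χ t) - ∫ t in (0 : ℝ)..x, χ t =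
      ∫ t in (x : ℝ)..y, χ t := fun x y =>
    intervalIntegral.integral_interval_sub_left (hχ _ _) (hχ _ _)
  refine ⟨fun x => ∫ t in (0 : ℝ)..x, χ t,
    (intervalIntegral.continuous_primitive hχ 0).comp continuous_subtype_val, ?_, ?_⟩
  · intro x y h
    refine (sub_eq_zero.1 ?_).symm
    rw [hdiff, intervalIntegral.integral_congr (g := fun _ => (0 : ℝ)),
      intervalIntegral.integral_zero]
    intro t ht
    refine Set.indicator_of_notMem ?_ _
    rintro ⟨z, hz, rfl⟩
    refine h z ?_ hz
    rw [Set.mem_uIcc] at ht ⊢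
    exact ht
  · intro x y hxy h heq
    have h1 := hdiff x y
    rw [sub_eq_zero.2 heq.symm, intervalIntegral.integral_congr (g := fun _ => (1 : ℝ))] at h1
    · have : x.1 < y.1 := hxy
      simp at h1
      linarith
    · intro t ht
      rw [Set.uIcc_of_le (show x.1 ≤ y.1 from hxy.le)] at ht
      exact Set.indicator_of_mem (show t ∈ K from
        ⟨⟨t, x.2.1.trans ht.1, ht.2.trans y.2.2⟩, h _ ⟨ht.1, ht.2⟩, rfl⟩) 1

/-! ### Finiteness of the set of gaps -/

theorem Icc_subset_of_connectedComponent_eq {K : Set UI} {p q : K}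
    (h : connectedComponent p = connectedComponent q) : Set.Icc p.1 q.1 ⊆ K := by
  have hpre : IsPreconnected (Subtype.val '' connectedComponent p) :=
    isPreconnected_connectedComponent.image _ continuous_subtype_val.continuousOn
  refine (hpre.Icc_subset ⟨p, mem_connectedComponent, rfl⟩
    ⟨q, h ▸ mem_connectedComponent, rfl⟩).trans ?_
  rintro _ ⟨z, _, rfl⟩
  exact z.2

/-- The relation of lying in the same gap, on the points moved by `g`. -/
def gapSetoid (g : Equiv.Perm UI) : Setoid {x : UI // g x ≠ x} where
  r x y := SameGap g x y
  iseqv := ⟨fun x => SameGap.refl x.2, SameGap.symm, SameGap.trans⟩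

theorem finite_gaps {g : Equiv.Perm UI} (hg : StrictMono g)
    (hfin : Finite (ConnectedComponents {x : UI | g x = x})) : Finite (Quotient (gapSetoid g)) := by
  have hbot : g ⊥ = ⊥ := (StrictMono.orderIsoOfSurjective g hg g.surjective).map_bot
  have hclosed : IsClosed {z : UI | g z = z} :=
    isClosed_eq (continuous_perm_of_strictMono hg) continuous_id
  have hleft : ∀ x : UI, ∃ a : {x : UI | g x = x}, a.1 ≤ x ∧ ∀ z, g z = z → z ≤ x → z ≤ a.1 := by
    intro x
    have hlub := isLUB_sSup ({z : UI | g z = z} ∩ Set.Iic x)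
    have hmem := (hclosed.inter isClosed_Iic).isCompact.sSup_mem
      (show ({z : UI | g z = z} ∩ Set.Iic x).Nonempty from ⟨⊥, hbot, Set.mem_Iic.2 bot_le⟩)
    exact ⟨⟨_, hmem.1⟩, hmem.2, fun z hz hzx => hlub.1 ⟨hz, hzx⟩⟩
  choose a ha ha' using hleft
  have key : ∀ x y : {x : UI // g x ≠ x}, x.1 ≤ y.1 →
      connectedComponent (a x) = connectedComponent (a y) → SameGap g x y := by
    intro x y hxy h z hz hgz
    rw [Set.uIcc_of_le hxy] at hz
    exact x.2 (Icc_subset_of_connectedComponent_eq h ⟨ha x, hz.1.trans (ha' y z hgz hz.2)⟩)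
  refine Finite.of_injective
    (fun q : Quotient (gapSetoid g) => ConnectedComponents.mk (a q.out.1)) fun q q' h => ?_
  rw [ConnectedComponents.coe_eq_coe] at h
  rw [← q.out_eq, ← q'.out_eq]
  refine Quotient.sound ?_
  rcases le_total q.out.1 q'.out.1 with hle | hle
  · exact key _ _ hle h
  · exact (key _ _ hle h.symm).symm

/-! ### Unbounded Birkhoff sums for increasing permutations -/

theorem SuspUnbounded.symm {Y : Type*} {f : Equiv.Perm Y} {T : Y → ℝ} {x y : Y}
    (h : SuspUnbounded f T x y) : SuspUnbounded f T y x := fun B =>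
  (h B).imp fun n hn => by rwa [abs_sub_comm]

theorem suspUnbounded_of_fixed {Y : Type*} {f : Equiv.Perm Y} {T : Y → ℝ} {x y : Y}
    (hx : f x = x) (hy : f y = y) (h : T x ≠ T y) : SuspUnbounded f T x y := by
  intro B
  obtain ⟨n, hn⟩ := exists_nat_gt (B / |T x - T y|)
  refine ⟨n, ?_⟩
  rw [div_lt_iff₀ (abs_pos.2 (sub_ne_zero.2 h))] at hn
  simp only [suspSum_natCast, zpow_apply_eq_self hx, zpow_apply_eq_self hy, Finset.sum_const,
    Finset.card_range, nsmul_eq_mul, ← mul_sub, abs_mul, Nat.abs_cast]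
  exact hn

theorem dist_le_dist_of_mem_uIcc {x y z : UI} (h : z ∈ Set.uIcc x y) : dist x z ≤ dist x y :=
  Real.dist_left_le_of_mem_uIcc (by
    rw [Set.mem_uIcc] at h ⊢
    exact h)

theorem mem_uIcc_of_monotone {X : Type*} [LinearOrder X] {g : X → X} (hg : Monotone g) {x y z : X}
    (h : z ∈ Set.uIcc x y) : g z ∈ Set.uIcc (g x) (g y) := by
  rw [Set.mem_uIcc] at h ⊢
  exact h.imp (fun h => ⟨hg h.1, hg h.2⟩) fun h => ⟨hg h.1, hg h.2⟩

theorem exists_suspUnbounded {g : Equiv.Perm UI} (hg : StrictMono g)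
    (hfin : Finite (ConnectedComponents {x : UI | g x = x})) :
    ∃ W : UI → ℝ, Continuous W ∧ ∃ ρ > (0 : ℝ), ∀ x y, x ≠ y →
      (∀ n : ℤ, dist ((g ^ n) x) ((g ^ n) y) < ρ) → SuspUnbounded g W x y := by
  have := finite_gaps hg hfin
  have := Fintype.ofFinite (Quotient (gapSetoid g))
  set ι := Quotient (gapSetoid g)
  set m : ι → UI := fun i => i.out.1
  have hrep : ∀ x, g x ≠ x → ∃ i, SameGap g x (m i) := fun x hx =>
    ⟨Quotient.mk (gapSetoid g) ⟨x, hx⟩,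
      SameGap.symm (Quotient.mk_out (s := gapSetoid g) (⟨x, hx⟩ : {x : UI // g x ≠ x}))⟩
  have hrep_unique : ∀ i j, SameGap g (m i) (m j) → i = j := fun i j h => by
    rw [← i.out_eq, ← j.out_eq]
    exact Quotient.sound h
  have d : ∀ i, GapDomain g (m i) := fun i => (gapDomain_nonempty hg i.out.2).some
  choose O hO hOD hO0 using fun i => (d i).exists_oscillation hg
  obtain ⟨b, hb, hbgap, hbfix⟩ := exists_base hg
  obtain ⟨ρ, hρ, hρc⟩ : ∃ ρ > (0 : ℝ), ∀ i, ρ ≤ (d i).c := by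
    rcases isEmpty_or_nonempty ι with h | h
    · exact ⟨1, one_pos, fun i => h.elim i⟩
    · obtain ⟨i, hi⟩ := Finite.exists_min fun i => (d i).c
      exact ⟨_, (d i).c_pos, hi⟩
  set W : UI → ℝ := fun x => b x + ∑ i, O i x with hW
  have hWc : Continuous W := hb.add (continuous_finsetSum _ fun i _ => hO i)
  have hne : ∀ {x}, g x ≠ x → ∀ n : ℤ, g ((g ^ n) x) ≠ (g ^ n) x := fun hx n =>
    (sameGap_zpow_apply hg hx n).symm.ne_left
  have hWD : ∀ i, ∀ x ∈ (d i).D, ∀ k : ℤ,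
      W ((g ^ k) x) = b x + harmonicAmp ((d i).φ x) ((d i).ψ x) k := by
    intro i x hx k
    have hxgap := (d i).sameGap x hx
    have hk := sameGap_zpow_apply hg hxgap.ne_left k
    rw [hW, ← hOD i x hx k, hbgap _ _ hk]
    simp only [add_right_inj]
    refine Finset.sum_eq_single_of_mem i (Finset.mem_univ _) fun j _ hj => hO0 j _ fun l hl => ?_
    have hl' := sameGap_zpow_apply hg (hne hxgap.ne_left k) l
    exact hj (hrep_unique _ _
      (((d j).sameGap _ hl).symm.trans (hl'.symm.trans (hk.symm.trans hxgap))))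
  have hW0 : ∀ x, g x = x → W x = b x := by
    intro x hx
    simp only [hW]
    rw [Finset.sum_eq_zero, add_zero]
    intro i _
    refine hO0 i x fun k hk => ((d i).sameGap _ hk).ne_left ?_
    rw [zpow_apply_eq_self hx, hx]
  have hfar : ∀ x p, g x ≠ x → g p = p → ∃ n : ℤ, ρ ≤ dist ((g ^ n) x) p := by
    intro x p hx hp
    obtain ⟨i, hi⟩ := hrep x hx
    obtain ⟨n, hn⟩ := (d i).covering x hi
    exact ⟨n, (hρc i).trans ((d i).le_dist_fixed _ hn p hp)⟩
  have hsep : ∀ x y z, g x ≠ x → g z = z → z ∈ Set.uIcc x y →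
      ∃ n : ℤ, ρ ≤ dist ((g ^ n) x) ((g ^ n) y) := by
    intro x y z hx hz hxyz
    obtain ⟨n, hn⟩ := hfar x z hx hz
    have := mem_uIcc_of_monotone (strictMono_perm_zpow hg n).monotone hxyz
    rw [zpow_apply_eq_self hz] at this
    exact ⟨n, hn.trans (dist_le_dist_of_mem_uIcc this)⟩
  have hfixed : ∀ x y, x < y → g x = x → g y = y → dist x y < ρ → SuspUnbounded g W x y := by
    intro x y hxy hx hy hd
    by_cases hall : ∀ z ∈ Set.Icc x y, g z = z
    · exact suspUnbounded_of_fixed hx hy (by rw [hW0 x hx, hW0 y hy]; exact hbfix x y hxy hall)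
    · push Not at hall
      obtain ⟨z, hz, hgz⟩ := hall
      obtain ⟨n, hn⟩ := hfar z x hgz hx
      have := mem_uIcc_of_monotone (strictMono_perm_zpow hg n).monotone (Set.Icc_subset_uIcc hz)
      rw [zpow_apply_eq_self hx, zpow_apply_eq_self hy] at this
      rw [dist_comm] at hn
      exact absurd ((hn.trans (dist_le_dist_of_mem_uIcc this)).trans_lt hd) (lt_irrefl _)
  refine ⟨W, hWc, ρ, hρ, fun x y hxy hd => ?_⟩
  by_cases hx : g x = x
  · by_cases hy : g y = y
    · have hd0 : dist x y < ρ := by simpa using hd 0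
      rcases lt_or_gt_of_ne hxy with h | h
      · exact hfixed x y h hx hy hd0
      · exact (hfixed y x h hy hx (by rwa [dist_comm])).symm
    · obtain ⟨n, hn⟩ := hsep y x x hy hx Set.right_mem_uIcc
      rw [dist_comm] at hn
      exact absurd (hd n) (not_lt.2 hn)
  by_cases hgap : SameGap g x y
  · obtain ⟨i, hi⟩ := hrep x hx
    obtain ⟨n, hn⟩ := (d i).covering x hi
    obtain ⟨l, hl⟩ := (d i).covering y (hgap.symm.trans hi)
    by_cases heq : (g ^ n) x = (g ^ l) y
    · have hy : (g ^ n) y = (g ^ (n - l)) ((g ^ n) x) := by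
        rw [heq, ← Equiv.Perm.mul_apply, ← zpow_add, sub_add_cancel]
      have hnl : n - l ≠ 0 := fun h => hxy (by
        rw [sub_eq_zero.1 h] at heq
        exact (g ^ l).injective heq)
      have h1 := (hρc i).trans ((d i).le_dist_zpow _ hn _ hnl)
      rw [← hy] at h1
      exact absurd (hd n) (not_lt.2 h1)
    · obtain ⟨B, hB⟩ := isCompact_univ.exists_bound_of_continuousOn hWc.continuousOn
      refine SuspUnbounded.of_zpow_apply (B := B) (fun x => hB x trivial) (k := n) (l := l) ?_
      have hbxy : b ((g ^ l) y) = b ((g ^ n) x) :=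
        hbgap _ _ (((d i).sameGap _ hl).trans ((d i).sameGap _ hn).symm)
      have hWy := hWD i _ hl
      rw [hbxy] at hWy
      refine suspUnbounded_of_harmonicAmp (hWD i _ hn) hWy ?_
      by_contra! h
      exact heq ((d i).separating _ hn _ hl h.1 h.2)
  · rw [SameGap] at hgap
    push Not at hgap
    obtain ⟨z, hz, hgz⟩ := hgap
    obtain ⟨n, hn⟩ := hsep x y z hx hgz hz
    exact absurd (hd n) (not_lt.2 hn)

theorem suspSum_add_const {Y : Type*} (f : Equiv.Perm Y) (T : Y → ℝ) (c : ℝ) (n : ℤ) (x : Y) :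
    suspSum f (fun z => T z + c) n x = suspSum f T n x + n * c := by
  refine (eq_suspSum_of_add_one f _ (h := fun n => suspSum f T n x + n * c)
    (by simp [suspSum_zero]) (fun n => ?_) n).symm
  rw [suspSum_add_one]
  push_cast
  ring

theorem exists_pos_suspUnbounded {g : Equiv.Perm UI} (hg : StrictMono g)
    (hfin : Finite (ConnectedComponents {x : UI | g x = x})) :
    ∃ W : UI → ℝ, Continuous W ∧ (∀ x, 0 < W x) ∧ ∃ ρ > (0 : ℝ), ∀ x y, x ≠ y →
      (∀ n : ℤ, dist ((g ^ n) x) ((g ^ n) y) < ρ) → SuspUnbounded g W x y := by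
  obtain ⟨W, hW, ρ, hρ, h⟩ := exists_suspUnbounded hg hfin
  obtain ⟨B, hB⟩ := isCompact_univ.exists_bound_of_continuousOn hW.continuousOn
  refine ⟨fun x => W x + (B + 1), by fun_prop, fun x => ?_, ρ, hρ, fun x y hxy hd C => ?_⟩
  · have := (abs_le.1 (hB x trivial)).1
    linarith
  · simpa only [suspSum_add_const, add_sub_add_right_eq_sub] using h x y hxy hd C

theorem SuspKinExpansive.of_suspUnbounded {Y : Type*} [MetricSpace Y] {f : Equiv.Perm Y}
    {T : Y → ℝ} {ρ : ℝ} (hρ : 0 < ρ) (h : ∀ x y, x ≠ y →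
      (∀ n : ℤ, dist ((f ^ n) x) ((f ^ n) y) < ρ) → SuspUnbounded f T x y) :
    SuspKinExpansive f T := by
  refine ⟨ρ, hρ, fun x y hxy => by_contra fun hne => ?_⟩
  obtain ⟨n, hn⟩ := h x y hne (fun n => (hxy n).1) ρ
  exact lt_asymm hn (hxy n).2

theorem zpow_of_mul_self {G : Type*} [Group G] (f : G) (n : ℤ) : (f * f) ^ n = f ^ (2 * n) := by
  rw [zpow_mul, zpow_two]

/-! ### Decreasing permutations -/

/-- Points on one side of an isolated fixed point do not stay close to it. -/
theorem exists_le_dist_of_isolated {g : Equiv.Perm UI} (hg : StrictMono g) {p : UI} {ε : ℝ}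
    (hε : 0 < ε) (hiso : ∀ x, g x = x → dist x p < ε → x = p) {x : UI} (hx : p < x) :
    ∃ n : ℤ, ε / 2 ≤ dist ((g ^ n) x) p := by
  by_contra! h
  have hmem := sSup_mem_closure (s := Set.range fun n : ℤ => (g ^ n) x) (Set.range_nonempty _)
  have hball := (Metric.isClosed_closedBall (x := p) (ε := ε / 2)).closure_subset_iff.2
    (by rintro _ ⟨n, rfl⟩; exact (h n).le) hmem
  rw [Metric.mem_closedBall] at hball
  have hp := hiso _ (apply_sSup_orbit hg x) (by linarith)
  have : x ≤ sSup (Set.range fun n : ℤ => (g ^ n) x) := le_sSup ⟨0, by simp⟩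
  exact absurd (hp ▸ this) (not_le.2 hx)

theorem exists_suspKinExpansive_of_strictAnti {f : Equiv.Perm UI} (hf : StrictAnti f) {p : UI}
    (hp : f p = p) {ε : ℝ} (hε : 0 < ε) (hiso : ∀ x, (f * f) x = x → dist x p < ε → x = p)
    (hfin : Finite (ConnectedComponents {x : UI | (f * f) x = x})) :
    ∃ T : UI → ℝ, Continuous T ∧ (∀ x, 0 < T x) ∧ SuspKinExpansive f T := by
  have hg : StrictMono (f * f : Equiv.Perm UI) := hf.comp hf
  have hgp : (f * f) p = p := by rw [Equiv.Perm.mul_apply, hp, hp]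
  obtain ⟨W, hW, hpos, ρ, hρ, h⟩ := exists_pos_suspUnbounded hg hfin
  have hT : Continuous fun x => W (max x p) := by fun_prop
  refine ⟨fun x => W (max x p), hT, fun x => hpos _,
    SuspKinExpansive.of_suspUnbounded (lt_min hρ (half_pos hε)) fun x y hxy hd => ?_⟩
  have hle : ∀ z, p ≤ z → ∀ n : ℤ, p ≤ ((f * f) ^ n) z := fun z hz n => by
    simpa [zpow_apply_eq_self hgp] using (strictMono_perm_zpow hg n).monotone hz
  have hsum : ∀ z, p ≤ z → ∀ n : ℤ, suspSum f (fun x => W (max x p)) (2 * n) z =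
      suspSum (f * f) W n z + n * W p := by
    intro z hz n
    rw [← suspSum_add_const]
    refine eq_suspSum_of_add_one (f * f) _
      (h := fun n => suspSum f (fun x => W (max x p)) (2 * n) z) (by simp [suspSum_zero])
      (fun n => ?_) n
    have hz1 := hle z hz n
    have hz2 := hf.antitone hz1
    rw [hp] at hz2
    rw [show 2 * (n + 1) = 2 * n + 1 + 1 by ring, suspSum_add_one, suspSum_add_one,
      zpow_add_one_apply, ← zpow_of_mul_self, max_eq_left hz1, max_eq_right hz2, add_assoc]
  have hright : ∀ x y, p ≤ x → p ≤ y → x ≠ y → (∀ n : ℤ, dist ((f ^ n) x) ((f ^ n) y) < ρ) →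
      SuspUnbounded f (fun x => W (max x p)) x y := by
    intro x y hx hy hxy hd B
    obtain ⟨n, hn⟩ := h x y hxy (fun n => by rw [zpow_of_mul_self]; exact hd _) B
    exact ⟨2 * n, by rwa [hsum x hx, hsum y hy, add_sub_add_right_eq_sub]⟩
  have hcross : ∀ x y, x ≤ p → p < y → ∃ n : ℤ, ε / 2 ≤ dist ((f ^ n) x) ((f ^ n) y) := by
    intro x y hx hy
    obtain ⟨n, hn⟩ := exists_le_dist_of_isolated hg hε hiso hy
    refine ⟨2 * n, ?_⟩
    rw [← zpow_of_mul_self, dist_comm]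
    refine hn.trans (dist_le_dist_of_mem_uIcc ?_)
    have := mem_uIcc_of_monotone (strictMono_perm_zpow hg n).monotone
      (Set.mem_uIcc.2 (Or.inr ⟨hx, hy.le⟩))
    rwa [zpow_apply_eq_self hgp] at this
  have hdρ : ∀ n : ℤ, dist ((f ^ n) x) ((f ^ n) y) < ρ := fun n =>
    (hd n).trans_le (min_le_left _ _)
  have hdε : ∀ n : ℤ, dist ((f ^ n) x) ((f ^ n) y) < ε / 2 := fun n =>
    (hd n).trans_le (min_le_right _ _)
  rcases le_or_gt x p with hx | hx
  · rcases le_or_gt y p with hy | hy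
    · obtain ⟨B, hB⟩ := isCompact_univ.exists_bound_of_continuousOn hT.continuousOn
      refine SuspUnbounded.of_zpow_apply (B := B) (fun x => hB x trivial) (k := 1) (l := 1) ?_
      rw [zpow_one]
      refine hright _ _ (hp ▸ hf.antitone hx) (hp ▸ hf.antitone hy) (f.injective.ne hxy)
        fun n => ?_
      rw [← Equiv.Perm.mul_apply, ← Equiv.Perm.mul_apply, ← zpow_add_one]
      exact hdρ _
    · obtain ⟨n, hn⟩ := hcross x y hx hy
      exact absurd (hdε n) (not_lt.2 hn)
  · rcases le_or_gt p y with hy | hy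
    · exact hright x y hx.le hy hxy hdρ
    · obtain ⟨n, hn⟩ := hcross y x hy.le hx
      rw [dist_comm] at hn
      exact absurd (hdε n) (not_lt.2 hn)

/-! ### Consequences of kinematic expansiveness -/

/-- Kinematic expansiveness forbids moved points whose orbits under `f`, or under both `f * f` and
its translate by `f`, stay in small sets. -/
theorem SuspKinExpansive.exists_rigidity {Y : Type*} [MetricSpace Y] [CompactSpace Y]
    {f : Equiv.Perm Y} {T : Y → ℝ} (hT : Continuous T) (h : SuspKinExpansive f T) :
    ∃ δ > (0 : ℝ), (∀ x, (∀ n : ℤ, dist ((f ^ n) x) x < δ) → f x = x) ∧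
      ∀ x, (∀ n : ℤ, dist (((f * f) ^ n) x) x < δ ∧ dist (f (((f * f) ^ n) x)) (f x) < δ) →
        (f * f) x = x := by
  obtain ⟨ρ, hρ, h⟩ := h
  obtain ⟨δ, hδ, hTδ⟩ := Metric.uniformContinuous_iff.1
    (CompactSpace.uniformContinuous_of_continuous hT) (ρ / 2) (half_pos hρ)
  have hclose : ∀ a b c : Y, dist a c < min δ (ρ / 2) → dist b c < min δ (ρ / 2) →
      dist a b < ρ := fun a b c h1 h2 => by
    have h1' := h1.trans_le (min_le_right _ _)
    have h2' := h2.trans_le (min_le_right _ _)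
    have := dist_triangle_right a b c
    linarith
  have hTclose : ∀ a b : Y, dist a b < min δ (ρ / 2) → |T a - T b| < ρ / 2 := fun a b hab =>
    hTδ (hab.trans_le (min_le_left _ _))
  refine ⟨min δ (ρ / 2), lt_min hδ (half_pos hρ), fun x hx => h _ _ fun n => ⟨?_, ?_⟩,
    fun x hx => h _ _ fun n => ?_⟩
  · rw [← Equiv.Perm.mul_apply, ← zpow_add_one]
    exact hclose _ _ x (hx _) (hx _)
  · have := suspSum_zpow_apply_sub f T n 1 x
    rw [zpow_one] at this
    rw [this, suspSum_one, suspSum_one]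
    exact (hTclose _ _ (hx n)).trans (half_lt_self hρ)
  · have hsum := suspSum_zpow_apply_sub f T n 2 x
    rw [zpow_two, suspSum_two, suspSum_two] at hsum
    rw [hsum]
    obtain ⟨k, rfl | rfl⟩ := n.even_or_odd'
    · rw [← zpow_of_mul_self, ← Equiv.Perm.mul_apply, ← zpow_add_one]
      refine ⟨hclose _ _ x (hx _).1 (hx _).1, ?_⟩
      have h1 := abs_lt.1 (hTclose _ _ (hx k).1)
      have h2 := abs_lt.1 (hTclose _ _ (hx k).2)
      exact abs_lt.2 ⟨by linarith, by linarith⟩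
    · rw [zpow_add_one_apply, zpow_add_one_apply, ← zpow_of_mul_self,
        ← Equiv.Perm.mul_apply ((f * f) ^ k), ← zpow_add_one]
      refine ⟨hclose _ _ (f x) (hx _).2 (hx _).2, ?_⟩
      have h1 := abs_lt.1 (hTclose _ _ (hx (k + 1)).1)
      have h2 := abs_lt.1 (hTclose _ _ (hx k).2)
      rw [zpow_add_one_apply, Equiv.Perm.mul_apply] at h1
      exact abs_lt.2 ⟨by linarith, by linarith⟩

theorem finite_connectedComponents_of_rigidity {g f : Equiv.Perm UI} (hg : StrictMono g)
    (hf : Continuous f) {δ : ℝ} (hδ : 0 < δ)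
    (h : ∀ x, (∀ n : ℤ, dist ((g ^ n) x) x < δ ∧ dist (f ((g ^ n) x)) (f x) < δ) → g x = x) :
    Finite (ConnectedComponents {x : UI | g x = x}) := by
  obtain ⟨η, hη, hfη⟩ := Metric.uniformContinuous_iff.1
    (CompactSpace.uniformContinuous_of_continuous hf) δ hδ
  have hsub : ∀ x y : UI, g x = x → g y = y → dist x y < min η δ →
      Set.uIcc x y ⊆ {x : UI | g x = x} := by
    intro x y hx hy hd z hz
    have hdz : ∀ n : ℤ, dist ((g ^ n) z) z < min η δ := fun n => by
      have h1 := mem_uIcc_of_monotone (strictMono_perm_zpow hg n).monotone hz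
      rw [zpow_apply_eq_self hx, zpow_apply_eq_self hy] at h1
      refine lt_of_le_of_lt ?_ hd
      rw [Set.mem_uIcc] at h1 hz
      exact Real.dist_le_of_mem_uIcc (Set.mem_uIcc.2 h1) (Set.mem_uIcc.2 hz)
    exact h z fun n => ⟨(hdz n).trans_le (min_le_right _ _), hfη ((hdz n).trans_le (min_le_left _ _))⟩
  have hloc : IsLocallyConstant
      (ConnectedComponents.mk : {x : UI | g x = x} → ConnectedComponents {x : UI | g x = x}) := by
    rw [IsLocallyConstant.iff_eventually_eq]
    intro x
    filter_upwards [Metric.ball_mem_nhds x (lt_min hη hδ)] with y hy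
    have hs := hsub y x y.2 x.2 hy
    have hpre : IsPreconnected
        (Subtype.val ⁻¹' Set.uIcc y.1 x.1 : Set {x : UI | g x = x}) := by
      rw [← Topology.IsInducing.subtypeVal.isPreconnected_image, Subtype.image_preimage_coe,
        Set.inter_eq_right.2 hs]
      exact isPreconnected_uIcc
    rw [ConnectedComponents.coe_eq_coe]
    exact connectedComponent_eq (hpre.subset_connectedComponent Set.left_mem_uIcc
      Set.right_mem_uIcc)
  have : CompactSpace {x : UI | g x = x} := isCompact_iff_compactSpace.1
    (isClosed_eq (continuous_perm_of_strictMono hg) continuous_id).isCompact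
  have hfin := hloc.range_finite
  rw [ConnectedComponents.surjective_coe.range_eq] at hfin
  exact Set.finite_univ_iff.1 hfin

theorem continuousOn_minimalPeriod_of_rigidity {Y : Type*} [MetricSpace Y] {f : Equiv.Perm Y}
    (hf : Continuous f) {δ : ℝ} (hδ : 0 < δ)
    (h : ∀ x, (∀ n : ℤ, dist ((f ^ n) x) x < δ) → f x = x) :
    ContinuousOn (fun x => (Function.minimalPeriod f x : ℝ)) {x | (f * f) x = x} := by
  intro p hp
  have hev : ∀ᶠ x in 𝓝[{x | (f * f) x = x}] p,
      Function.minimalPeriod f x = Function.minimalPeriod f p := by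
    by_cases hfp : f p = p
    · have h1 : ∀ᶠ x in 𝓝 p, dist x p < δ / 2 := Metric.ball_mem_nhds p (half_pos hδ)
      have h2 : ∀ᶠ x in 𝓝 p, dist (f x) p < δ / 2 :=
        hf.continuousAt.eventually (by rw [hfp]; exact Metric.ball_mem_nhds p (half_pos hδ))
      filter_upwards [self_mem_nhdsWithin, mem_nhdsWithin_of_mem_nhds h1,
        mem_nhdsWithin_of_mem_nhds h2] with x hx hx1 hx2
      have hfx : f x = x := h x fun n => by
        obtain ⟨k, rfl | rfl⟩ := n.even_or_odd'
        · rw [← zpow_of_mul_self, zpow_apply_eq_self hx, dist_self]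
          exact hδ
        · rw [zpow_add_one_apply, ← zpow_of_mul_self, zpow_apply_eq_self hx]
          exact (dist_triangle_right _ _ p).trans_lt (by linarith)
      rw [Function.minimalPeriod_eq_one_iff_isFixedPt.2 hfx,
        Function.minimalPeriod_eq_one_iff_isFixedPt.2 hfp]
    · have hne : ∀ᶠ x in 𝓝 p, f x ≠ x :=
        (isOpen_ne_fun hf continuous_id).mem_nhds hfp
      filter_upwards [self_mem_nhdsWithin, mem_nhdsWithin_of_mem_nhds hne] with x hx hfx
      have htwo : ∀ z, (f * f) z = z → f z ≠ z → Function.minimalPeriod f z = 2 :=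
        fun z hz hfz => Function.minimalPeriod_eq_prime (p := 2) hz hfz
      rw [htwo x hx hfx, htwo p hp hfp]
  refine tendsto_const_nhds.congr' ?_
  filter_upwards [hev] with x hx
  simp only [hx]

/-! ### The characterisation -/

theorem setOf_periodic_eq_of_strictMono {X : Type*} [LinearOrder X] {f : Equiv.Perm X}
    (hf : StrictMono f) : {x | ∃ k : ℕ, 1 ≤ k ∧ (f ^ k) x = x} = {x | f x = x} := by
  ext x
  refine ⟨?_, fun hx => ⟨1, le_rfl, by simpa using hx⟩⟩
  rintro ⟨k, hk, hx⟩
  have := (Function.Commute.id_right (f := f)).iterate_pos_eq_iff_map_eq hf.monotone strictMono_id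
    (x := x) hk
  rw [Function.iterate_id, ← Equiv.Perm.coe_pow] at this
  exact this.1 hx

theorem setOf_periodic_eq_of_mul_self {X : Type*} [LinearOrder X] {f : Equiv.Perm X}
    (hf : StrictMono (f * f : Equiv.Perm X)) :
    {x | ∃ k : ℕ, 1 ≤ k ∧ (f ^ k) x = x} = {x | (f * f) x = x} := by
  rw [← setOf_periodic_eq_of_strictMono hf]
  ext x
  refine ⟨?_, ?_⟩
  · rintro ⟨k, hk, hx⟩
    refine ⟨k, hk, ?_⟩
    rw [(Commute.refl f).mul_pow, Equiv.Perm.mul_apply, hx, hx]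
  · rintro ⟨k, hk, hx⟩
    exact ⟨2 * k, by omega, by rwa [pow_mul, pow_two]⟩

/-- A homeomorphism of `[0,1]` admits a kinematic expansive suspension iff its
set of periodic points has finitely many connected components and the minimal
period function is continuous on the set of periodic points. -/
theorem stmt8 (f : Equiv.Perm (Set.Icc (0 : ℝ) 1))
    (hf : Continuous f) (hf' : Continuous f.symm) :
    (∃ T : (Set.Icc (0 : ℝ) 1) → ℝ, Continuous T ∧ (∀ x, 0 < T x) ∧
        SuspKinExpansive f T) ↔
      (Finite (ConnectedComponents
          ({x : Set.Icc (0 : ℝ) 1 | ∃ k : ℕ, 1 ≤ k ∧ (f ^ k) x = x} : Set _)) ∧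
        ContinuousOn (fun x => (Function.minimalPeriod (⇑f) x : ℝ))
          {x : Set.Icc (0 : ℝ) 1 | ∃ k : ℕ, 1 ≤ k ∧ (f ^ k) x = x}) := by
  have hmono := hf.strictMono_of_inj f.injective
  have hg : StrictMono (f * f : Equiv.Perm UI) :=
    hmono.elim (fun h => h.comp h) fun h => h.comp h
  constructor
  · rintro ⟨T, hT, -, h⟩
    obtain ⟨δ, hδ, h1, h2⟩ := h.exists_rigidity hT
    rw [setOf_periodic_eq_of_mul_self hg]
    exact ⟨finite_connectedComponents_of_rigidity hg hf hδ h2,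
      continuousOn_minimalPeriod_of_rigidity hf hδ h1⟩
  · rintro ⟨hfin, hcont⟩
    rcases hmono with hmono | hanti
    · rw [setOf_periodic_eq_of_strictMono hmono] at hfin
      obtain ⟨T, hT, hpos, ρ, hρ, h⟩ := exists_pos_suspUnbounded hmono hfin
      exact ⟨T, hT, hpos, SuspKinExpansive.of_suspUnbounded hρ h⟩
    · rw [setOf_periodic_eq_of_mul_self hg] at hfin hcont
      obtain ⟨p, hp⟩ : ∃ p : UI, f p = p :=
        intermediate_value_univ₂ (a := (⊤ : UI)) (b := ⊥) hf continuous_id le_top bot_le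
      have hgp : (f * f) p = p := by rw [Equiv.Perm.mul_apply, hp, hp]
      obtain ⟨ε, hε, h⟩ := Metric.continuousWithinAt_iff.1 (hcont p hgp) 1 one_pos
      refine exists_suspKinExpansive_of_strictAnti hanti hp hε (fun x hx hd => ?_) hfin
      have h1 := h hx hd
      rw [Function.minimalPeriod_eq_one_iff_isFixedPt.2 hp, Real.dist_eq, abs_lt] at h1
      have h2 : (0 : ℝ) < Function.minimalPeriod f x := by
        have := h1.1
        push_cast at this
        linarith
      have h3 : (Function.minimalPeriod f x : ℝ) < 2 := by
        have := h1.2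
        push_cast at this
        linarith
      have h4 : Function.minimalPeriod f x = 1 := by
        have h2' : 0 < Function.minimalPeriod f x := by exact_mod_cast h2
        have h3' : Function.minimalPeriod f x < 2 := by exact_mod_cast h3
        omega
      have hfx : f x = x := Function.minimalPeriod_eq_one_iff_isFixedPt.1 h4
      rcases lt_trichotomy x p with hlt | heq | hlt
      · have := hanti hlt
        rw [hfx, hp] at this
        exact absurd this hlt.asymm
      · exact heq
      · have := hanti hlt
        rw [hfx, hp] at this
        exact absurd this hlt.asymm
end

section
/- Let I = [0,1], let f : I → I be a homeomorphism and let T : I → (0,∞) be continuously differentiable. If the suspension pair (f,T) is kinematic expansive, then f is the identity map of I and T is strictly increasing or strictly decreasing. -/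
open Metric Set Filter Topology

/-- A continuous function on an interval taking equal values at its endpoints takes equal values at
arbitrarily close distinct points. -/
theorem exists_ne_close_of_eq {g : ℝ → ℝ} (hg : Continuous g) {a b : ℝ} (hab : a < b)
    (h : g a = g b) {ρ : ℝ} (hρ : 0 < ρ) :
    ∃ u ∈ Icc a b, ∃ v ∈ Icc a b, u < v ∧ v - u < ρ ∧ g u = g v := by
  obtain ⟨c, hc, hext⟩ := exists_isLocalExtr_Ioo hab hg.continuousOn h
  have key : ∀ k : ℝ → ℝ, Continuous k → IsLocalMax k c →
      ∃ u ∈ Icc a b, ∃ v ∈ Icc a b, u < v ∧ v - u < ρ ∧ k u = k v := by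
    intro k hk hmax
    obtain ⟨δ, hδ, hball⟩ := Metric.eventually_nhds_iff.1 hmax
    obtain ⟨r, hr, hr'⟩ := exists_between
      (show (0 : ℝ) < min (min (c - a) (b - c)) (min δ (ρ / 2)) from
        lt_min (lt_min (sub_pos.2 hc.1) (sub_pos.2 hc.2)) (lt_min hδ (by positivity)))
    simp only [lt_min_iff] at hr'
    obtain ⟨⟨h1, h2⟩, h3, h4⟩ := hr'
    have hl : k (c - r) ≤ k c := hball (by simpa [Real.dist_eq, abs_of_pos hr] using h3)
    have hu : k (c + r) ≤ k c := hball (by simpa [Real.dist_eq, abs_of_pos hr] using h3)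
    rcases le_total (k (c - r)) (k (c + r)) with hle | hle
    · obtain ⟨w, hw, hwe⟩ := intermediate_value_Icc (by linarith : c - r ≤ c) hk.continuousOn
        ⟨hle, hu⟩
      exact ⟨w, ⟨by linarith [hw.1], by linarith [hw.2]⟩, c + r, ⟨by linarith, by linarith⟩,
        by linarith [hw.2], by linarith [hw.1], hwe⟩
    · obtain ⟨w, hw, hwe⟩ := intermediate_value_Icc' (by linarith : c ≤ c + r) hk.continuousOn
        ⟨hle, hl⟩
      exact ⟨c - r, ⟨by linarith, by linarith⟩, w, ⟨by linarith [hw.1], by linarith [hw.2]⟩,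
        by linarith [hw.1], by linarith [hw.2], hwe.symm⟩
  rcases hext with hmin | hmax
  · obtain ⟨u, hu, v, hv, h1, h2, h3⟩ := key (fun x => -g x) hg.neg hmin.neg
    exact ⟨u, hu, v, hv, h1, h2, neg_injective h3⟩
  · exact key g hg hmax

theorem continuous_zpow_perm {Y : Type*} [TopologicalSpace Y] {f : Equiv.Perm Y}
    (hf : Continuous f) (hf' : Continuous f.symm) (n : ℤ) : Continuous (f ^ n : Equiv.Perm Y) := by
  have hnat : ∀ (k : Equiv.Perm Y), Continuous k → ∀ m : ℕ, Continuous (k ^ m : Equiv.Perm Y) := by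
    intro k hk m
    rw [Equiv.Perm.coe_pow]
    exact hk.iterate m
  obtain ⟨m, rfl | rfl⟩ := n.eq_nat_or_neg
  · simpa using hnat f hf m
  · rw [zpow_neg, zpow_natCast, ← inv_pow]
    exact hnat f⁻¹ hf' m

/-- The Birkhoff sums along the orbits of `x` and `f x` differ by a coboundary. -/
theorem suspSum_apply_sub {Y : Type*} (f : Equiv.Perm Y) (T : Y → ℝ) (n : ℤ) (x : Y) :
    suspSum f T n (f x) - suspSum f T n x = T ((f ^ n) x) - T x := by
  have hsucc : ∀ m : ℤ, (f ^ m) (f x) = (f ^ (m + 1)) x := fun m => by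
    rw [zpow_add_one, Equiv.Perm.mul_apply]
  unfold suspSum
  split_ifs with hn
  · obtain ⟨m, rfl⟩ := Int.eq_ofNat_of_zero_le hn
    rw [← Finset.sum_sub_distrib]
    simp only [hsucc, Int.toNat_natCast]
    have := Finset.sum_range_sub (fun i : ℕ => T ((f ^ (i : ℤ)) x)) m
    push_cast at this
    simpa using this
  · obtain ⟨m, hm⟩ := Int.eq_ofNat_of_zero_le (show 0 ≤ -n by omega)
    obtain rfl : n = -m := by omega
    rw [neg_sub_neg, ← Finset.sum_sub_distrib]
    simp only [hsucc, neg_neg, Int.toNat_natCast]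
    have := Finset.sum_range_sub (fun i : ℕ => T ((f ^ (-(i : ℤ))) x)) m
    push_cast at this
    simpa [neg_add, sub_eq_add_neg, add_comm] using this

theorem abs_suspSum_sub_le {Y : Type*} (f : Equiv.Perm Y) (T : Y → ℝ) (x y : Y)
    (hs : Summable fun i : ℤ => |T ((f ^ i) x) - T ((f ^ i) y)|) (n : ℤ) :
    |suspSum f T n x - suspSum f T n y| ≤ ∑' i : ℤ, |T ((f ^ i) x) - T ((f ^ i) y)| := by
  have key : ∀ (e : ℕ → ℤ) (_ : Function.Injective e) (m : ℕ),
      |∑ i ∈ Finset.range m, T ((f ^ e i) x) - ∑ i ∈ Finset.range m, T ((f ^ e i) y)| ≤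
        ∑' i : ℤ, |T ((f ^ i) x) - T ((f ^ i) y)| := by
    intro e he m
    rw [← Finset.sum_sub_distrib]
    refine (Finset.abs_sum_le_sum_abs _ _).trans ?_
    have := hs.sum_le_tsum ((Finset.range m).map ⟨e, he⟩) (fun _ _ => abs_nonneg _)
    simpa using this
  unfold suspSum
  split_ifs with hn
  · exact key (fun i => (i : ℤ)) Nat.cast_injective _
  · rw [neg_sub_neg, abs_sub_comm]
    exact key (fun i => -(i : ℤ) - 1) (fun i j hij => by simpa using hij) _

theorem summable_dist_succ_of_monotone {u : ℕ → Icc (0 : ℝ) 1} (hu : Monotone u ∨ Antitone u) :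
    Summable fun n => dist (u (n + 1)) (u n) := by
  refine summable_of_sum_range_le (c := 1) (fun _ => dist_nonneg) fun n => ?_
  have h0 := (u 0).2
  have hn := (u n).2
  rcases hu with hu | hu
  · have : ∀ i, dist (u (i + 1)) (u i) = (u (i + 1) : ℝ) - u i := fun i => by
      rw [Subtype.dist_eq, Real.dist_eq, abs_of_nonneg (sub_nonneg.2 (Subtype.coe_le_coe.2 (hu i.le_succ)))]
    simp only [this, Finset.sum_range_sub (fun i => (u i : ℝ))]
    linarith [h0.1, hn.2]
  · have : ∀ i, dist (u (i + 1)) (u i) = (u i : ℝ) - u (i + 1) := fun i => by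
      rw [dist_comm, Subtype.dist_eq, Real.dist_eq,
        abs_of_nonneg (sub_nonneg.2 (Subtype.coe_le_coe.2 (hu i.le_succ)))]
    simp only [this, Finset.sum_range_sub' (fun i => (u i : ℝ))]
    linarith [hn.1, h0.2]

theorem summable_int_dist_succ_of_monotone {u : ℤ → Icc (0 : ℝ) 1}
    (hu : Monotone u ∨ Antitone u) : Summable fun n => dist (u (n + 1)) (u n) := by
  refine Summable.of_nat_of_neg_add_one ?_ ?_
  · have := summable_dist_succ_of_monotone (u := fun n : ℕ => u n)
      (hu.imp (fun h _ _ hij => h (by exact_mod_cast hij))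
        (fun h _ _ hij => h (by exact_mod_cast hij)))
    simpa using this
  · have := summable_dist_succ_of_monotone (u := fun n : ℕ => u (-n))
      (hu.symm.imp (fun h _ _ hij => h (by simpa using hij)) (fun h _ _ hij => h (by simpa using hij)))
    refine this.congr fun n => ?_
    rw [dist_comm]
    push_cast
    congr 2
    ring

theorem summable_int_of_even_of_odd {u : ℤ → ℝ} (he : Summable fun m => u (2 * m))
    (ho : Summable fun m => u (2 * m + 1)) : Summable u := by
  have hinj : Function.Injective fun m : ℤ => 2 * m := mul_right_injective₀ two_ne_zero
  have he' := hinj.hasSum_range_iff.2 he.hasSum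
  have ho' := ((add_left_injective (1 : ℤ)).comp hinj).hasSum_range_iff.2 ho.hasSum
  refine (he'.add_isCompl ?_ ho').summable
  simpa [Function.comp_def] using Int.isCompl_even_odd

section Interval

variable {f : Equiv.Perm (Icc (0 : ℝ) 1)}

/-- The orbits of `x` and `f (f x)` under a homeomorphism of the interval are summably close. -/
theorem summable_dist_zpow_apply_apply (hf : Continuous f) (hf' : Continuous f.symm)
    (x : Icc (0 : ℝ) 1) : Summable fun n : ℤ => dist ((f ^ n) (f (f x))) ((f ^ n) x) := by
  have hmono : ∀ m : ℤ, Monotone fun z => (f ^ (2 * m)) z := by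
    intro m
    have hcomp : (fun z => (f ^ (2 * m)) z) = (f ^ m : Equiv.Perm _) ∘ (f ^ m : Equiv.Perm _) := by
      funext z
      rw [two_mul, zpow_add]
      rfl
    rw [hcomp]
    rcases (continuous_zpow_perm hf hf' m).strictMono_of_inj_boundedOrder' (f ^ m).injective
      with h | h
    · exact h.monotone.comp h.monotone
    · exact h.antitone.comp h.antitone
  have hstep : ∀ (m : ℤ) (z : Icc (0 : ℝ) 1),
      (f ^ (2 * (m + 1))) z = (f ^ (2 * m)) (f (f z)) := fun m z => by
    rw [mul_add, zpow_add]
    rfl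
  have hz : ∀ z : Icc (0 : ℝ) 1,
      Summable fun m : ℤ => dist ((f ^ (2 * m)) (f (f z))) ((f ^ (2 * m)) z) := by
    intro z
    have := summable_int_dist_succ_of_monotone (u := fun m => (f ^ (2 * m)) z)
      ((le_total z (f (f z))).imp
        (fun h => monotone_int_of_le_succ fun m => by rw [hstep]; exact hmono m h)
        (fun h => antitone_int_of_succ_le fun m => by rw [hstep]; exact hmono m h))
    simpa only [hstep] using this
  refine summable_int_of_even_of_odd (hz x) ?_
  refine (hz (f x)).congr fun m => ?_
  rw [zpow_add_one]
  rfl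

theorem dist_zpow_le_of_mem_uIcc (hf : Continuous f) (hf' : Continuous f.symm)
    {x y z : Icc (0 : ℝ) 1} (hy : y ∈ uIcc x z) (n : ℤ) :
    dist ((f ^ n) y) ((f ^ n) x) ≤ dist ((f ^ n) z) ((f ^ n) x) := by
  have hmem : (f ^ n) y ∈ uIcc ((f ^ n) x) ((f ^ n) z) := by
    rcases (continuous_zpow_perm hf hf' n).strictMono_of_inj_boundedOrder' (f ^ n).injective
      with h | h
    · exact h.monotone.mapsTo_uIcc hy
    · exact h.antitone.mapsTo_uIcc hy
  rw [dist_comm _ ((f ^ n) x), dist_comm _ ((f ^ n) x), Subtype.dist_eq, Subtype.dist_eq]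
  refine Real.dist_left_le_of_mem_uIcc ?_
  rw [mem_uIcc] at hmem ⊢
  exact hmem

theorem exists_ne_tsum_dist_zpow_lt (hf : Continuous f) (hf' : Continuous f.symm)
    {x : Icc (0 : ℝ) 1} (hx : f (f x) ≠ x) {ε : ℝ} (hε : 0 < ε) :
    ∃ y, y ≠ x ∧ (Summable fun n : ℤ => dist ((f ^ n) y) ((f ^ n) x)) ∧
      ∑' n : ℤ, dist ((f ^ n) y) ((f ^ n) x) < ε := by
  set z := f (f x) with hz
  have hsum := summable_dist_zpow_apply_apply hf hf' x
  let t : ℕ → ℝ := fun k => 1 / ((k : ℝ) + 1)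
  have ht0 : ∀ k, 0 < t k := fun k => Nat.one_div_pos_of_nat
  have ht1 : ∀ k, t k ≤ 1 := fun k => by
    have := Nat.one_div_le_one_div (α := ℝ) (Nat.zero_le k)
    simpa [t] using this
  let y : ℕ → Icc (0 : ℝ) 1 := fun k =>
    ⟨x + t k * (z - x), by
      have hx' := x.2
      have hz' := z.2
      constructor <;> nlinarith [ht0 k, ht1 k, hx'.1, hx'.2, hz'.1, hz'.2]⟩
  have hy : ∀ k, (y k : ℝ) = x + t k * (z - x) := fun _ => rfl
  have hmem : ∀ k, y k ∈ uIcc x z := fun k => by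
    rw [mem_uIcc]
    refine (le_total x z).imp (fun h => ?_) (fun h => ?_) <;>
    · have h' : (_ : ℝ) ≤ _ := h
      rw [← Subtype.coe_le_coe, ← Subtype.coe_le_coe, hy]
      constructor <;> nlinarith [ht0 k, ht1 k]
  have hlim : Tendsto y atTop (𝓝 x) := by
    rw [tendsto_subtype_rng]
    have : Tendsto (fun k => (x : ℝ) + t k * (z - x)) atTop (𝓝 (x + 0 * (z - x))) :=
      tendsto_const_nhds.add (tendsto_one_div_add_atTop_nhds_zero_nat.mul_const _)
    simpa using this
  have htend : Tendsto (fun k => ∑' n : ℤ, dist ((f ^ n) (y k)) ((f ^ n) x)) atTop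
      (𝓝 (∑' _ : ℤ, (0 : ℝ))) := by
    refine tendsto_tsum_of_dominated_convergence hsum (fun n => ?_) (Eventually.of_forall ?_)
    · rw [← tendsto_iff_dist_tendsto_zero]
      exact ((continuous_zpow_perm hf hf' n).tendsto x).comp hlim
    · intro k n
      rw [Real.norm_of_nonneg dist_nonneg]
      exact dist_zpow_le_of_mem_uIcc hf hf' (hmem k) n
  rw [tsum_zero] at htend
  obtain ⟨k, hk⟩ := (htend.eventually (gt_mem_nhds hε)).exists
  refine ⟨y k, fun h => ?_, hsum.of_nonneg_of_le (fun _ => dist_nonneg)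
    (dist_zpow_le_of_mem_uIcc hf hf' (hmem k)), hk⟩
  have h' := hy k
  rw [h] at h'
  have : t k * ((z : ℝ) - x) = 0 := by linarith
  rcases mul_eq_zero.1 this with h0 | h0
  · exact (ht0 k).ne' h0
  · exact hx (Subtype.ext (sub_eq_zero.1 h0))

variable {T : Icc (0 : ℝ) 1 → ℝ}

theorem apply_apply_of_suspKinExpansive (hf : Continuous f) (hf' : Continuous f.symm)
    {K : NNReal} (hT : LipschitzWith K T) (hexp : SuspKinExpansive f T) (x : Icc (0 : ℝ) 1) :
    f (f x) = x := by
  by_contra hx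
  obtain ⟨ρ, hρ, hexp⟩ := hexp
  obtain ⟨y, hyx, hs, hlt⟩ :=
    exists_ne_tsum_dist_zpow_lt hf hf' hx (show 0 < ρ / (K + 1) by positivity)
  rw [lt_div_iff₀ (by positivity)] at hlt
  set S := ∑' n : ℤ, dist ((f ^ n) y) ((f ^ n) x) with hS
  have hS0 : 0 ≤ S := tsum_nonneg fun _ => dist_nonneg
  have hK : (0 : ℝ) ≤ K := K.2
  have hbound : ∀ n : ℤ, |T ((f ^ n) y) - T ((f ^ n) x)| ≤ K * dist ((f ^ n) y) ((f ^ n) x) :=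
    fun n => hT.dist_le_mul _ _
  have hs' : Summable fun n : ℤ => |T ((f ^ n) y) - T ((f ^ n) x)| :=
    (hs.mul_left (K : ℝ)).of_nonneg_of_le (fun _ => abs_nonneg _) hbound
  refine hyx (hexp y x fun n => ⟨?_, ?_⟩)
  · have := hs.le_tsum n fun _ _ => dist_nonneg
    nlinarith
  · have h1 := abs_suspSum_sub_le f T y x hs' n
    have h2 := hs'.tsum_le_tsum hbound (hs.mul_left (K : ℝ))
    rw [tsum_mul_left] at h2
    nlinarith

theorem apply_of_suspKinExpansive_of_involutive (hf : Continuous f) (hinv : ∀ x, f (f x) = x)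
    {K : NNReal} (hT : LipschitzWith K T) (hexp : SuspKinExpansive f T) (x : Icc (0 : ℝ) 1) :
    f x = x := by
  obtain ⟨ρ, hρ, hexp⟩ := hexp
  by_contra hx
  have hlt : ∃ a, a < f a := by
    rcases lt_or_gt_of_ne hx with h | h
    · exact ⟨f x, by rwa [hinv]⟩
    · exact ⟨x, h⟩
  obtain ⟨a, ha⟩ := hlt
  have ha' : (0 : ℝ) < f a - a := sub_pos.2 ha
  obtain ⟨c, hc0, hc⟩ := exists_between (lt_min ha' (show 0 < ρ / (K + 1) by positivity))
  rw [lt_min_iff, lt_div_iff₀ (by positivity)] at hc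
  have hcont : Continuous fun z : Icc (0 : ℝ) 1 => (f z : ℝ) - z := by fun_prop
  obtain ⟨y, hy⟩ := mem_range_of_exists_le_of_exists_ge hcont (c := c)
    ⟨f a, by simp only [hinv]; linarith⟩ ⟨a, hc.1.le⟩
  have hy' : (f y : ℝ) - y = c := hy
  have hd : dist (f y) y = c := by
    rw [Subtype.dist_eq, Real.dist_eq, hy', abs_of_pos hc0]
  have hK : (0 : ℝ) ≤ K := K.2
  have hTd : |T (f y) - T y| ≤ K * c := hd ▸ hT.dist_le_mul (f y) y
  have horb : ∀ n : ℤ, (f ^ n) y = y ∨ (f ^ n) y = f y := by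
    have hsq : f ^ (2 : ℤ) = 1 := by
      ext z
      change ((f (f z) : Icc (0 : ℝ) 1) : ℝ) = z
      rw [hinv]
    intro n
    obtain ⟨m, rfl | rfl⟩ := n.even_or_odd'
    · left
      rw [zpow_mul, hsq, one_zpow, Equiv.Perm.one_apply]
    · right
      rw [zpow_add, zpow_mul, hsq, one_zpow, one_mul, zpow_one]
  have hne : f y = y := hexp (f y) y fun n => by
    constructor
    · have hcomm : (f ^ n) (f y) = f ((f ^ n) y) := by
        rw [← Equiv.Perm.mul_apply, ← Equiv.Perm.mul_apply, ← zpow_add_one, ← zpow_one_add,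
          add_comm]
      rw [hcomm]
      rcases horb n with h | h
      · rw [h, hd]
        nlinarith
      · rw [h, hinv, dist_comm, hd]
        nlinarith
    · rw [suspSum_apply_sub]
      rcases horb n with h | h
      · simpa [h] using hρ
      · rw [h]
        nlinarith
  rw [hne, sub_self] at hy'
  exact hc0.ne hy'

theorem strictMono_or_strictAnti_of_suspKinExpansive_of_eq_one (hid : f = 1)
    {g : ℝ → ℝ} (hg : Continuous g) (hTg : ∀ x : Icc (0 : ℝ) 1, T x = g x)
    (hexp : SuspKinExpansive f T) : StrictMono T ∨ StrictAnti T := by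
  subst hid
  obtain ⟨ρ, hρ, hexp⟩ := hexp
  have hloc : ∀ x y : Icc (0 : ℝ) 1, dist x y < ρ → T x = T y → x = y := fun x y hd hT =>
    hexp x y fun n => by simpa [suspSum, hT] using ⟨hd, hρ⟩
  have hlt : ∀ x y : Icc (0 : ℝ) 1, x < y → T x ≠ T y := by
    intro x y hxy hT
    rw [hTg, hTg] at hT
    obtain ⟨u, hu, v, hv, huv, hd, he⟩ := exists_ne_close_of_eq hg hxy hT hρ
    have hI : Icc (x : ℝ) y ⊆ Icc 0 1 := Icc_subset_Icc x.2.1 y.2.2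
    have := hloc ⟨u, hI hu⟩ ⟨v, hI hv⟩
      (by rwa [Subtype.dist_eq, dist_comm, Real.dist_eq, abs_of_pos (sub_pos.2 huv)])
      (by rw [hTg, hTg]; exact he)
    exact huv.ne (congrArg Subtype.val this)
  have hcont : Continuous T := by
    rw [funext hTg]
    fun_prop
  refine hcont.strictMono_of_inj_boundedOrder' fun x y hxy => ?_
  by_contra hne
  rcases lt_or_gt_of_ne hne with h | h
  · exact hlt x y h hxy
  · exact hlt y x h hxy.symm

end Interval

/-- If `f` is a homeomorphism of `[0,1]`, `T` is positive and `C¹`, and the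
suspension pair `(f, T)` is kinematic expansive, then `f` is the identity and
`T` is strictly increasing or strictly decreasing. -/
theorem stmt9 (f : Equiv.Perm (Set.Icc (0 : ℝ) 1))
    (hf : Continuous f) (hf' : Continuous f.symm)
    (T : (Set.Icc (0 : ℝ) 1) → ℝ) (hTpos : ∀ x, 0 < T x)
    (hT : ∃ g : ℝ → ℝ, ContDiff ℝ 1 g ∧ ∀ x : Set.Icc (0 : ℝ) 1, T x = g x)
    (hexp : SuspKinExpansive f T) :
    (∀ x, f x = x) ∧ (StrictMono T ∨ StrictAnti T) := by
  obtain ⟨g, hg, hTg⟩ := hT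
  obtain ⟨K, hK⟩ := hg.contDiffOn.exists_lipschitzOnWith one_ne_zero (convex_Icc (0 : ℝ) 1)
    isCompact_Icc
  have hTlip : LipschitzWith K T := by
    rw [funext hTg]
    exact hK.to_restrict
  have hid := apply_of_suspKinExpansive_of_involutive hf
    (apply_apply_of_suspKinExpansive hf hf' hTlip hexp) hTlip hexp
  exact ⟨hid, strictMono_or_strictAnti_of_suspKinExpansive_of_eq_one (Equiv.ext hid)
    hg.continuous hTg hexp⟩
end

section
/- If φ is a kinematic expansive continuous flow on the closed unit disc D = {p ∈ ℝ² : |p| ≤ 1}, then φ has a singular point in the interior of D (some p with |p| < 1 and φ_t(p) = p for all t). -/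
open Metric Set Filter Topology

/-- A nowhere vanishing continuous function on a convex set has a continuous logarithm. -/
theorem exists_continuousOn_log {F : Type*} [AddCommGroup F] [Module ℝ F] [TopologicalSpace F]
    [IsTopologicalAddGroup F] [ContinuousSMul ℝ F] {S : Set F} (hS : Convex ℝ S) {f : F → ℂ}
    (hf : ContinuousOn f S) (h0 : ∀ x ∈ S, f x ≠ 0) :
    ∃ L : F → ℂ, ContinuousOn L S ∧ ∀ x ∈ S, Complex.exp (L x) = f x := by
  rcases S.eq_empty_or_nonempty with rfl | hne
  · exact ⟨0, by simp⟩
  have := hS.contractibleSpace hne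
  obtain ⟨x₀, ⟨H⟩⟩ := id_nullhomotopic S
  let g : C(S, {z : ℂ // z ≠ 0}) :=
    ⟨fun x ↦ ⟨f x, h0 x x.2⟩, (continuousOn_iff_continuous_domRestrict.1 hf).subtype_mk _⟩
  let H' : C(unitInterval × S, {z : ℂ // z ≠ 0}) := g.comp H.symm.toContinuousMap
  have hH0 : ∀ x, H' (0, x) = ⟨Complex.exp (ContinuousMap.const S (Complex.log (f x₀)) x),
      Complex.exp_ne_zero _⟩ := by
    intro x
    have : H.symm (0, x) = x₀ := by simp
    refine Subtype.ext ?_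
    change f (H.symm (0, x)) = Complex.exp (Complex.log (f x₀))
    rw [this, Complex.exp_log (h0 x₀ x₀.2)]
  have hlift := Complex.isCoveringMap_exp.liftHomotopy_lifts H' _ hH0
  set G := Complex.isCoveringMap_exp.liftHomotopy H' _ hH0
  classical
  refine ⟨fun x ↦ if hx : x ∈ S then G (1, ⟨x, hx⟩) else 0, ?_, fun x hx ↦ ?_⟩
  · rw [continuousOn_iff_continuous_domRestrict]
    have : Continuous fun x : S ↦ G (1, x) := by fun_prop
    refine this.congr fun x ↦ ?_
    simp
  · have := congr_arg Subtype.val (congr_fun hlift (1, ⟨x, hx⟩))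
    have h1 : f (H.symm (1, ⟨x, hx⟩)) = f x := by simp
    simp only [dif_pos hx, ← h1]
    exact this

/-- A continuous function whose exponential is constant on a preconnected set is constant there. -/
theorem eq_of_exp_eq_const {A : Type*} [TopologicalSpace A] {S : Set A} (hS : IsPreconnected S)
    {g : A → ℂ} (hg : ContinuousOn g S) {w : ℂ} (h : ∀ a ∈ S, Complex.exp (g a) = w)
    {a b : A} (ha : a ∈ S) (hb : b ∈ S) : g a = g b :=
  Complex.isCoveringMap_exp.constOn_of_comp hS hg
    (fun a ha b hb ↦ Subtype.ext ((h a ha).trans (h b hb).symm)) ha hb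

theorem exists_eq_add_of_exp_eq_mul {A : Type*} [TopologicalSpace A] {S : Set A}
    (hS : IsPreconnected S) (hne : S.Nonempty) {f g : A → ℂ} (hf : ContinuousOn f S)
    (hg : ContinuousOn g S) {w : ℂ} (h : ∀ a ∈ S, Complex.exp (f a) = Complex.exp (g a) * w) :
    ∃ N, Complex.exp N = w ∧ ∀ a ∈ S, f a = g a + N := by
  obtain ⟨a, ha⟩ := hne
  have key : ∀ b ∈ S, Complex.exp (f b - g b) = w := fun b hb ↦ by
    rw [Complex.exp_sub, h b hb, mul_div_cancel_left₀ _ (Complex.exp_ne_zero _)]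
  refine ⟨f a - g a, key a ha, fun b hb ↦ ?_⟩
  have : f b - g b = f a - g a := eq_of_exp_eq_const hS (hf.sub hg) key hb ha
  linear_combination this

/-- If the exponential of a path stays in the right half plane, then its imaginary part cannot
leave `(-π / 2, π / 2)`. -/
theorem abs_im_lt_of_exp_re_pos {d : ℝ → ℂ} (hd : ContinuousOn d (Icc 0 1))
    (h : ∀ r ∈ Icc (0 : ℝ) 1, 0 < (Complex.exp (d r)).re) (h0 : |(d 0).im| < Real.pi / 2) :
    |(d 1).im| < Real.pi / 2 := by
  by_contra! h1
  have hc : ContinuousOn (fun r ↦ |(d r).im|) (uIcc 0 1) := by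
    rw [uIcc_of_le zero_le_one]
    exact (Complex.continuous_im.comp_continuousOn hd).abs
  obtain ⟨r, hr, hr'⟩ := intermediate_value_uIcc hc
    (by rw [uIcc_of_le (h0.le.trans h1)]; exact ⟨h0.le, h1⟩ : Real.pi / 2 ∈ _)
  rw [uIcc_of_le zero_le_one] at hr
  replace hr' : |(d r).im| = Real.pi / 2 := hr'
  have := h r hr
  rw [Complex.exp_re, ← Real.cos_abs, hr'] at this
  simp at this

theorem re_div_pos_of_norm_sub_lt {f g : ℂ} (h : ‖f - g‖ < ‖g‖) : 0 < (f / g).re := by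
  have hg : g ≠ 0 := by rintro rfl; simp at h; exact absurd h (not_lt.2 (norm_nonneg _))
  have h1 : ‖f / g - 1‖ < 1 := by
    rw [div_sub_one hg, norm_div, div_lt_one (norm_pos_iff.2 hg)]
    exact h
  have := (Complex.abs_re_le_norm (f / g - 1)).trans_lt h1
  rw [abs_lt] at this
  simp at this
  linarith [this.1]

/-- A flow on the closed unit disc of `ℂ`, extended to the plane by a retraction onto the disc. -/
structure IsDiscFlow (ψ : ℝ → ℂ → ℂ) : Prop where
  continuous : Continuous fun q : ℝ × ℂ ↦ ψ q.1 q.2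
  norm_le : ∀ t z, ‖ψ t z‖ ≤ 1
  zero : ∀ z, ‖z‖ ≤ 1 → ψ 0 z = z
  add : ∀ s t z, ψ s (ψ t z) = ψ (s + t) z

/-- The nonsingular points of `ψ` in the closed unit disc. -/
def regularSet (ψ : ℝ → ℂ → ℂ) : Set ℂ := {z | ‖z‖ ≤ 1 ∧ ∃ t, ψ t z ≠ z}

namespace IsDiscFlow

variable {ψ : ℝ → ℂ → ℂ}

theorem reverse (h : IsDiscFlow ψ) : IsDiscFlow fun t z ↦ ψ (-t) z where
  continuous := h.continuous.comp (by fun_prop : Continuous fun q : ℝ × ℂ ↦ (-q.1, q.2))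
  norm_le t z := h.norm_le _ _
  zero z hz := by simpa using h.zero z hz
  add s t z := by rw [h.add, neg_add]

theorem comp_continuous (h : IsDiscFlow ψ) {A : Type*} [TopologicalSpace A] {f : A → ℝ}
    {g : A → ℂ} (hf : Continuous f) (hg : Continuous g) : Continuous fun a ↦ ψ (f a) (g a) :=
  h.continuous.comp (hf.prodMk hg)

theorem inverse (h : IsDiscFlow ψ) (t : ℝ) {z : ℂ} (hz : ‖z‖ ≤ 1) : ψ (-t) (ψ t z) = z := by
  rw [h.add, neg_add_cancel, h.zero z hz]

theorem injective (h : IsDiscFlow ψ) (t : ℝ) {z w : ℂ} (hz : ‖z‖ ≤ 1) (hw : ‖w‖ ≤ 1)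
    (hzw : ψ t z = ψ t w) : z = w := by
  rw [← h.inverse t hz, hzw, h.inverse t hw]

theorem sub_of_eq (h : IsDiscFlow ψ) {s t : ℝ} {z : ℂ} (hz : ‖z‖ ≤ 1) (hst : ψ s z = ψ t z) :
    ψ (t - s) z = z := by
  rw [sub_eq_neg_add, ← h.add, ← hst, h.inverse s hz]

theorem regularSet_flow (h : IsDiscFlow ψ) {z : ℂ} (hz : z ∈ regularSet ψ) (s : ℝ) :
    ψ s z ∈ regularSet ψ := by
  obtain ⟨hz, t, ht⟩ := hz
  refine ⟨h.norm_le _ _, t, fun hs ↦ ht ?_⟩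
  rw [h.add, add_comm, ← h.add] at hs
  exact h.injective s (h.norm_le _ _) hz hs

theorem convex_regularSet (hint : ∀ z : ℂ, ‖z‖ < 1 → ∃ t, ψ t z ≠ z) :
    Convex ℝ (regularSet ψ) := by
  rw [convex_iff_pairwise_pos]
  intro x hx y hy hxy a b ha hb hab
  have := strictConvex_closedBall ℝ (0 : ℂ) 1 (by simpa using hx.1) (by simpa using hy.1) hxy
    ha hb hab
  rw [interior_closedBall _ one_ne_zero, mem_ball_zero_iff] at this
  exact ⟨this.le, hint _ this⟩

/-- Near a regular point there are no periodic points of small period. -/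
theorem exists_forall_ne (h : IsDiscFlow ψ) {K : Set ℂ} (hK : IsCompact K)
    (hKr : K ⊆ regularSet ψ) : ∃ τ > 0, ∀ z ∈ K, ∀ s, 0 < s → s ≤ τ → ψ s z ≠ z := by
  have key : ∀ᶠ τ in 𝓝 (0 : ℝ), ∀ z ∈ K, ∃ t, ∀ r, |r| ≤ |τ| → ψ t z ≠ ψ r z := by
    refine hK.eventually_forall_of_forall_eventually fun z hz ↦ ?_
    obtain ⟨hz1, t, ht⟩ := hKr hz
    have h1 : Continuous fun q : ℝ × ℂ ↦ ψ t q.2 := h.comp_continuous continuous_const continuous_snd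
    have h2 := (h1.continuousAt.ne_iff_eventually_ne (x := (0, z)) h.continuous.continuousAt).1
      (by simpa [h.zero z hz1] using ht)
    rw [Metric.eventually_nhds_iff] at h2 ⊢
    obtain ⟨ε, hε, h2⟩ := h2
    refine ⟨ε, hε, fun q hq ↦ ⟨t, fun r hr ↦ h2 (y := (r, q.2)) ?_⟩⟩
    rw [Prod.dist_eq, max_lt_iff, Real.dist_0_eq_abs] at hq ⊢
    exact ⟨hr.trans_lt hq.1, hq.2⟩
  obtain ⟨ε, hε, key⟩ := Metric.eventually_nhds_iff.1 key
  refine ⟨ε / 2, half_pos hε, fun z hz s hs hsε hsz ↦ ?_⟩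
  obtain ⟨t, ht⟩ := key (y := s) (by rw [Real.dist_0_eq_abs, abs_of_pos hs]; linarith) z hz
  have hper : Function.Periodic (fun u ↦ ψ u z) s := fun u ↦ by
    change ψ (u + s) z = ψ u z
    rw [← h.add, hsz]
  obtain ⟨r, hr, hr'⟩ := hper.exists_mem_Ico₀ hs t
  exact ht r (by rw [abs_of_pos hs, abs_of_nonneg hr.1]; exact hr.2.le) hr'

/-- A compact subset of the regular set is contained in a compact convex one. -/
theorem exists_compact_convex (hint : ∀ z : ℂ, ‖z‖ < 1 → ∃ t, ψ t z ≠ z) {γ : Set ℂ}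
    (hγ : IsCompact γ) (hγr : γ ⊆ regularSet ψ) :
    ∃ K, IsCompact K ∧ Convex ℝ K ∧ γ ⊆ K ∧ K ⊆ regularSet ψ := by
  have hsub : closure (convexHull ℝ γ) ⊆ closedBall 0 1 :=
    closure_minimal (convexHull_min (fun z hz ↦ by simpa using (hγr hz).1)
      (convex_closedBall _ _)) isClosed_closedBall
  refine ⟨closure (convexHull ℝ γ), (isCompact_closedBall (0 : ℂ) 1).of_isClosed_subset
    isClosed_closure hsub, (convex_convexHull ℝ γ).closure,
    (subset_convexHull ℝ γ).trans subset_closure, fun p hp ↦ ?_⟩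
  have hp1 : ‖p‖ ≤ 1 := by simpa using hsub hp
  by_contra hps
  have hps' : ∀ t, ψ t p = p := by
    by_contra! hcon
    exact hps ⟨hp1, hcon⟩
  have hpn : ‖p‖ = 1 := hp1.antisymm <| by
    by_contra! hlt
    obtain ⟨t, ht⟩ := hint p hlt
    exact ht (hps' t)
  have hne : γ.Nonempty := by
    by_contra! hcon
    simp [hcon] at hp
  obtain ⟨z₀, hz₀, hmax⟩ := hγ.exists_isMaxOn hne
    (f := fun z ↦ inner ℝ p z) (by fun_prop)
  have hle : inner ℝ p p ≤ inner ℝ p z₀ := by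
    refine closure_minimal (convexHull_min (t := {z | inner ℝ p z ≤ inner ℝ p z₀}) hmax ?_) ?_ hp
    · exact convex_halfSpace_le (innerₗ ℂ p).isLinear _
    · exact isClosed_le (by fun_prop) continuous_const
  have h1 := norm_sub_sq_real p z₀
  rw [real_inner_self_eq_norm_sq, hpn] at hle
  rw [hpn] at h1
  have h2 : 0 < ‖p - z₀‖ := norm_pos_iff.2 <| sub_ne_zero.2 fun heq ↦ hps (heq ▸ hγr hz₀)
  nlinarith [(hγr hz₀).1, norm_nonneg z₀]

/-- A flow on the disc without interior singular points has no periodic orbits. -/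
theorem not_periodic (h : IsDiscFlow ψ) (hint : ∀ z : ℂ, ‖z‖ < 1 → ∃ t, ψ t z ≠ z) {x : ℂ}
    (hx : x ∈ regularSet ψ) {P : ℝ} (hP : 0 < P) : ψ P x ≠ x := by
  intro hPx
  have hc : Continuous fun t ↦ ψ t x := h.comp_continuous continuous_id continuous_const
  obtain ⟨K, hK, hKc, hγK, hKr⟩ := exists_compact_convex hint
    ((isCompact_Icc (a := -P) (b := P)).image hc) (by
      rintro _ ⟨t, -, rfl⟩
      exact h.regularSet_flow hx t)
  obtain ⟨τ, hτ, hτK⟩ := h.exists_forall_ne hK hKr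
  have hmem : ∀ t ∈ Icc (-P) P, ψ t x ∈ K := fun t ht ↦ hγK (mem_image_of_mem _ ht)
  have hxK : x ∈ K := by simpa [h.zero x hx.1] using hmem 0 ⟨by linarith, hP.le⟩
  have hτP : τ ≤ P := by
    by_contra! hcon
    exact hτK x hxK P hP hcon.le hPx
  -- the least period
  obtain ⟨Q, ⟨⟨hQτ, hQP⟩, hQx⟩, hQmin⟩ :=
    (isCompact_Icc.inter_right (isClosed_eq hc continuous_const) :
      IsCompact (Icc τ P ∩ {t | ψ t x = x})).exists_isLeast ⟨P, ⟨hτP, le_rfl⟩, hPx⟩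
  change ψ Q x = x at hQx
  have hτQ : τ < Q := hQτ.lt_of_ne fun heq ↦ hτK x hxK Q (hτ.trans_le hQτ) heq.ge hQx
  have hne : ∀ r, 0 < r → r < Q → ψ r x ≠ x := fun r hr hrQ hrx ↦ by
    rcases le_or_gt r τ with hrτ | hrτ
    · exact hτK x hxK r hr hrτ hrx
    · exact absurd (hQmin ⟨⟨hrτ.le, hrQ.le.trans hQP⟩, hrx⟩) (not_le.2 hrQ)
  have hper : ∀ u, ψ (u + Q) x = ψ u x := fun u ↦ by rw [← h.add, hQx]
  -- the argument of chords of the orbit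
  obtain ⟨L, hL, hLexp⟩ := exists_continuousOn_log
    (S := {q : ℝ × ℝ | 0 ≤ q.1 ∧ q.1 < q.2 ∧ q.2 ≤ Q ∧ q.2 - q.1 < Q})
    (f := fun q ↦ ψ q.2 x - ψ q.1 x) (by
      rintro p ⟨hp1, hp2, hp3, hp4⟩ q ⟨hq1, hq2, hq3, hq4⟩ a b ha hb hab
      obtain rfl : b = 1 - a := by linarith
      simp only [mem_ofPred_eq, Prod.fst_add, Prod.snd_add, Prod.smul_fst, Prod.smul_snd,
        smul_eq_mul]
      refine ⟨by positivity, ?_, by nlinarith, ?_⟩ <;>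
      · rcases ha.eq_or_lt with rfl | ha
        · linarith
        · nlinarith) (by fun_prop) (by
      rintro ⟨s, t⟩ ⟨-, h2, -, h4⟩
      exact sub_ne_zero.2 fun heq ↦ hne (t - s) (by simpa using h2) h4
        (h.sub_of_eq hx.1 heq.symm))
  obtain ⟨M, hM, hMexp⟩ := exists_continuousOn_log hKc (f := fun z ↦ ψ τ z - z)
    ((h.comp_continuous continuous_const continuous_id).sub continuous_id).continuousOn
    fun z hz ↦ sub_ne_zero.2 (hτK z hz τ hτ le_rfl)
  obtain ⟨N, hN, hLN⟩ := exists_eq_add_of_exp_eq_mul (isPreconnected_Ioo (a := 0) (b := Q))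
    ⟨τ, hτ, hτQ⟩ (f := fun t ↦ L (t, Q)) (g := fun t ↦ L (0, t)) (w := -1)
    (hL.comp (by fun_prop) fun t ht ↦ ⟨ht.1.le, ht.2, le_rfl, by simpa using ht.1⟩)
    (hL.comp (by fun_prop) fun t ht ↦ ⟨le_rfl, ht.1, ht.2.le, by simpa using ht.2⟩)
    fun t ht ↦ by
      rw [hLexp (t, Q) ⟨ht.1.le, ht.2, le_rfl, by simpa using ht.1⟩,
        hLexp (0, t) ⟨le_rfl, ht.1, ht.2.le, by simpa using ht.2⟩]
      simp [hQx, h.zero x hx.1]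
  obtain ⟨m, -, hLm⟩ := exists_eq_add_of_exp_eq_mul (isPreconnected_Icc (a := 0) (b := Q - τ))
    ⟨0, le_rfl, by linarith⟩ (f := fun s ↦ L (s, s + τ)) (g := fun s ↦ M (ψ s x)) (w := 1)
    (hL.comp (by fun_prop) fun s hs ↦ ⟨hs.1, by simpa, by simp; linarith [hs.2], by simpa⟩)
    (hM.comp hc.continuousOn fun s hs ↦ hmem s ⟨by linarith [hs.1], by linarith [hs.2]⟩)
    fun s hs ↦ by
      rw [hLexp (s, s + τ) ⟨hs.1, by simpa, by simp; linarith [hs.2], by simpa⟩,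
        hMexp _ (hmem s ⟨by linarith [hs.1], by linarith [hs.2]⟩), h.add, mul_one, add_comm τ]
  obtain ⟨n, -, hLn⟩ := exists_eq_add_of_exp_eq_mul (isPreconnected_Icc (a := 0) (b := τ))
    ⟨0, le_rfl, hτ.le⟩ (f := fun s ↦ L (s, s + (Q - τ))) (g := fun s ↦ M (ψ (s - τ) x)) (w := -1)
    (hL.comp (by fun_prop) fun s hs ↦ ⟨hs.1, by simpa, by simp; linarith [hs.2], by simpa⟩)
    (hM.comp (h.comp_continuous (by fun_prop) continuous_const).continuousOn
      fun s hs ↦ hmem _ ⟨by linarith [hs.1], by linarith [hs.2]⟩)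
    fun s hs ↦ by
      rw [hLexp (s, s + (Q - τ)) ⟨hs.1, by simpa, by simp; linarith [hs.2], by simpa⟩,
        hMexp _ (hmem _ ⟨by linarith [hs.1], by linarith [hs.2]⟩), h.add, add_sub_cancel,
        ← hper (s - τ), mul_neg_one, neg_sub, show s - τ + Q = s + (Q - τ) by ring]
  have e1 := hLN τ ⟨hτ, hτQ⟩
  have e2 := hLN (Q - τ) ⟨by linarith, by linarith⟩
  have e3 := hLm 0 ⟨le_rfl, by linarith⟩
  have e4 := hLm (Q - τ) ⟨by linarith, le_rfl⟩
  have e5 := hLn 0 ⟨le_rfl, hτ.le⟩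
  have e6 := hLn τ ⟨hτ.le, le_rfl⟩
  have e7 : ψ (Q - τ) x = ψ (0 - τ) x := by rw [← hper (0 - τ)]; congr 1; ring
  simp only [zero_add, sub_add_cancel, add_sub_cancel, sub_self] at e1 e2 e3 e4 e5 e6 e7
  rw [e7] at e4
  have hN0 : N = 0 := by linear_combination (e4 - e2 - e5 - e1 + e6 - e3) / 2
  rw [hN0, Complex.exp_zero] at hN
  norm_num at hN

theorem flow_ne_flow (h : IsDiscFlow ψ) (hint : ∀ z : ℂ, ‖z‖ < 1 → ∃ t, ψ t z ≠ z) {x : ℂ}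
    (hx : x ∈ regularSet ψ) {s t : ℝ} (hst : s ≠ t) : ψ s x ≠ ψ t x := by
  intro heq
  rcases hst.lt_or_gt with hlt | hlt
  · exact h.not_periodic hint hx (sub_pos.2 hlt) (h.sub_of_eq hx.1 heq)
  · exact h.not_periodic hint hx (sub_pos.2 hlt) (h.sub_of_eq hx.1 heq.symm)

/-- Close to a regular point, the flow is almost parallel and has no quick returns. -/
theorem exists_flow_box (h : IsDiscFlow ψ) (hint : ∀ z : ℂ, ‖z‖ < 1 → ∃ t, ψ t z ≠ z) {p : ℂ}
    (hp : p ∈ regularSet ψ) : ∃ ρ > 0, ∀ z ∈ ball p ρ, ∀ w ∈ ball p ρ,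
      (∀ r ∈ Icc (0 : ℝ) 1, ‖ψ r w - ψ r z‖ < ‖ψ r z - ψ (r - 1) z‖) ∧
        ∀ u ∈ Icc (2 : ℝ) 4, ψ u z ≠ w := by
  have h1 : ∀ᶠ q in 𝓝 (p, p), ∀ r ∈ Icc (0 : ℝ) 1,
      ‖ψ r q.2 - ψ r q.1‖ < ‖ψ r q.1 - ψ (r - 1) q.1‖ := by
    refine isCompact_Icc.eventually_forall_of_forall_eventually fun r _ ↦ ?_
    have ha : Continuous fun e : (ℂ × ℂ) × ℝ ↦ ψ e.2 e.1.1 :=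
      h.comp_continuous (by fun_prop) (by fun_prop)
    have hb : Continuous fun e : (ℂ × ℂ) × ℝ ↦ ψ e.2 e.1.2 :=
      h.comp_continuous (by fun_prop) (by fun_prop)
    have hc : Continuous fun e : (ℂ × ℂ) × ℝ ↦ ψ (e.2 - 1) e.1.1 :=
      h.comp_continuous (by fun_prop) (by fun_prop)
    refine ((hb.sub ha).norm.continuousAt.eventually_lt (ha.sub hc).norm.continuousAt ?_)
    simpa [sub_eq_zero] using h.flow_ne_flow hint hp (by linarith : r ≠ r - 1)
  have h2 : ∀ᶠ q in 𝓝 (p, p), ∀ u ∈ Icc (2 : ℝ) 4, ψ u q.1 ≠ q.2 := by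
    refine isCompact_Icc.eventually_forall_of_forall_eventually fun u hu ↦ ?_
    have ha : Continuous fun e : (ℂ × ℂ) × ℝ ↦ ψ e.2 e.1.1 :=
      h.comp_continuous (by fun_prop) (by fun_prop)
    exact (ha.continuousAt.ne_iff_eventually_ne (continuous_fst.snd.continuousAt)).1
      (h.not_periodic hint hp (by linarith [hu.1]))
  obtain ⟨ρ, hρ, H⟩ := Metric.eventually_nhds_iff.1 (h1.and h2)
  refine ⟨ρ, hρ, fun z hz w hw ↦ H (y := (z, w)) ?_⟩
  rw [Prod.dist_eq, max_lt_iff]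
  exact ⟨hz, hw⟩

/-- A simple closed curve formed by an orbit arc and a short transversal segment contradicts the
absence of singular points. -/
theorem false_of_closed_arc (h : IsDiscFlow ψ) (hint : ∀ z : ℂ, ‖z‖ < 1 → ∃ t, ψ t z ≠ z)
    {a : ℂ} {T : ℝ} (hT : 2 ≤ T) {q : ℝ → ℂ} (hq : Continuous q) (hq0 : q 0 = ψ T a)
    (hq1 : q 1 = a) (hqr : ∀ u ∈ Icc (0 : ℝ) 1, q u ∈ regularSet ψ)
    (hfree : ∀ u ∈ Ioo (0 : ℝ) 1, ∀ t ∈ Icc 0 T, q u ≠ ψ t a)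
    (hbox : ∀ u ∈ Icc (0 : ℝ) 1, ∀ v ∈ Icc (0 : ℝ) 1, ∀ r ∈ Icc (0 : ℝ) 1,
      ‖ψ r (q v) - ψ r (q u)‖ < ‖ψ r (q u) - ψ (r - 1) (q u)‖) : False := by
  have mem0 : (0 : ℝ) ∈ Icc (0 : ℝ) 1 := ⟨le_rfl, zero_le_one⟩
  have mem1 : (1 : ℝ) ∈ Icc (0 : ℝ) 1 := ⟨zero_le_one, le_rfl⟩
  have ha : a ∈ regularSet ψ := hq1 ▸ hqr 1 mem1
  have hc : Continuous fun t ↦ ψ t a := h.comp_continuous continuous_id continuous_const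
  have hreg : ∀ t, ψ t a ∈ regularSet ψ := h.regularSet_flow ha
  obtain ⟨Θ, hΘ, hΘexp⟩ := exists_continuousOn_log (S := regularSet ψ ×ˢ Ioi (0 : ℝ))
    ((convex_regularSet hint).prod (convex_Ioi 0)) (f := fun e ↦ ψ e.2 e.1 - e.1)
    ((h.comp_continuous continuous_snd continuous_fst).sub continuous_fst).continuousOn
    fun e he ↦ sub_ne_zero.2 (h.not_periodic hint he.1 he.2)
  have memΘ : ∀ z ∈ regularSet ψ, ∀ t : ℝ, 0 < t → (z, t) ∈ regularSet ψ ×ˢ Ioi (0 : ℝ) :=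
    fun z hz t ht ↦ ⟨hz, ht⟩
  let S : Set (ℝ × ℝ) := {e | e.1 ∈ Icc 0 1 ∧ e.2 ∈ Icc 0 T ∧ 0 < e.1 + (T - e.2) ∧
    0 < (1 - e.1) + e.2}
  obtain ⟨A, hA, hAexp⟩ := exists_continuousOn_log (S := S)
    (f := fun e ↦ q e.1 - ψ e.2 a) (by
      rintro p ⟨⟨hp1, hp2⟩, ⟨hp3, hp4⟩, hp5, hp6⟩ q ⟨⟨hq1, hq2⟩, ⟨hq3, hq4⟩, hq5, hq6⟩
        a b ha hb hab
      obtain rfl : b = 1 - a := by linarith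
      simp only [S, mem_ofPred_eq, Prod.fst_add, Prod.snd_add, Prod.smul_fst, Prod.smul_snd,
        smul_eq_mul, mem_Icc]
      refine ⟨⟨by positivity, by nlinarith⟩, ⟨by positivity, by nlinarith⟩, ?_, ?_⟩ <;>
      · rcases ha.eq_or_lt with rfl | ha
        · linarith
        · nlinarith)
    ((hq.comp continuous_fst).sub
      (h.comp_continuous continuous_snd continuous_const)).continuousOn (by
      rintro ⟨u, t⟩ ⟨hu, ht, h3, h4⟩
      simp only at hu ht h3 h4
      refine sub_ne_zero.2 ?_
      rcases hu.1.eq_or_lt with rfl | hu0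
      · simp only [hq0]
        exact h.flow_ne_flow hint ha (by linarith : t < T).ne'
      rcases hu.2.eq_or_lt with rfl | hu1
      · simp only [hq1]
        exact (h.not_periodic hint ha (by linarith : 0 < t)).symm
      · exact hfree u ⟨hu0, hu1⟩ t ht)
  have memA0 : ∀ t ∈ Ico 0 T, (0, t) ∈ S := fun t ht ↦
    ⟨mem0, ⟨ht.1, ht.2.le⟩, by simpa using ht.2, by simp; linarith [ht.1]⟩
  have memA1 : ∀ t ∈ Ioc 0 T, (1, t) ∈ S := fun t ht ↦
    ⟨mem1, ⟨ht.1.le, ht.2⟩, by simp; linarith [ht.2], by simpa using ht.1⟩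
  have memA : ∀ u ∈ Icc (0 : ℝ) 1, ∀ t ∈ Ioo 0 T, (u, t) ∈ S :=
    fun u hu t ht ↦ ⟨hu, ⟨ht.1.le, ht.2.le⟩, by simp; linarith [ht.2, hu.1],
      by simp; linarith [ht.1, hu.2]⟩
  obtain ⟨m, hm, hAm⟩ := exists_eq_add_of_exp_eq_mul (isPreconnected_Ico (a := 0) (b := T))
    ⟨0, le_rfl, by linarith⟩ (f := fun t ↦ A (0, t)) (g := fun t ↦ Θ (ψ t a, T - t)) (w := 1)
    (hA.comp (by fun_prop) memA0)
    (hΘ.comp (hc.prodMk (by fun_prop)).continuousOn fun t ht ↦ memΘ _ (hreg t) _ (sub_pos.2 ht.2))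
    fun t ht ↦ by
      rw [hAexp _ (memA0 t ht), hΘexp _ (memΘ _ (hreg t) _ (sub_pos.2 ht.2))]
      simp [h.add, hq0]
  obtain ⟨N, hN, hAN⟩ := exists_eq_add_of_exp_eq_mul (isPreconnected_Ioc (a := 0) (b := T))
    ⟨T, by linarith, le_rfl⟩ (f := fun t ↦ A (1, t)) (g := fun t ↦ Θ (a, t)) (w := -1)
    (hA.comp (by fun_prop) memA1) (hΘ.comp (by fun_prop) fun t ht ↦ memΘ _ ha _ ht.1)
    fun t ht ↦ by
      rw [hAexp _ (memA1 t ht), hΘexp _ (memΘ _ ha _ ht.1)]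
      simp [hq1]
  -- compare the argument of chords with the argument of the time-one displacement
  have h1 : |(A (1, T - 1) - m - Θ (ψ (T - 1) a, 1)).im| < Real.pi / 2 := by
    refine abs_im_lt_of_exp_re_pos (d := fun u ↦ A (u, T - 1) - m - Θ (ψ (T - 1) a, 1)) ?_ ?_ ?_
    · exact ((hA.comp (by fun_prop) fun u hu ↦ memA u hu _ ⟨by linarith, by linarith⟩).sub
        continuousOn_const).sub continuousOn_const
    · intro r hr
      rw [Complex.exp_sub, Complex.exp_sub, hm, div_one,
        hAexp _ (memA r hr _ ⟨by linarith, by linarith⟩), hΘexp _ (memΘ _ (hreg _) _ one_pos)]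
      refine re_div_pos_of_norm_sub_lt ?_
      have := hbox 0 mem0 r hr 0 mem0
      rw [h.zero _ (hqr _ mem0).1, h.zero _ (hqr _ hr).1, hq0, h.add] at this
      simp only [h.add]
      convert this using 2 <;> ring_nf
    · have := hAm (T - 1) ⟨by linarith, by linarith⟩
      simp only [sub_sub_cancel] at this
      rw [this]
      simp [Real.pi_pos]
  have h2 : |(Θ (ψ 1 a, T - 1) + N - m - Θ (ψ T a, 1)).im| < Real.pi / 2 := by
    have := abs_im_lt_of_exp_re_pos
      (d := fun r ↦ Θ (ψ r a, T - 1) + N - m - Θ (ψ (r + (T - 1)) a, 1)) ?_ ?_ ?_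
    · simpa using this
    · exact (((hΘ.comp (by fun_prop) fun r hr ↦ memΘ _ (hreg r) _ (by linarith)).add
        continuousOn_const).sub continuousOn_const).sub
        (hΘ.comp ((h.comp_continuous (by fun_prop) continuous_const).prodMk
          continuous_const).continuousOn fun r hr ↦ memΘ _ (hreg _) _ one_pos)
    · intro r hr
      rw [Complex.exp_sub, Complex.exp_sub, Complex.exp_add, hm, hN, div_one,
        hΘexp _ (memΘ _ (hreg _) _ (by linarith)), hΘexp _ (memΘ _ (hreg _) _ one_pos)]
      refine re_div_pos_of_norm_sub_lt ?_
      have := hbox 0 mem0 1 mem1 r hr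
      rw [hq0, hq1, h.add, h.add] at this
      simp only [h.add]
      convert this using 2 <;> ring_nf
    · rw [hAN (T - 1) ⟨by linarith, by linarith⟩] at h1
      simp only [h.zero a ha.1, zero_add]
      convert h1 using 3
  have h3 : |(A (1, 1) + N - 2 * m - Θ (a, 1)).im| < Real.pi / 2 := by
    have := abs_im_lt_of_exp_re_pos (d := fun u ↦ A (u, 1) + N - 2 * m - Θ (q u, 1)) ?_ ?_ ?_
    · simpa [hq1] using this
    · exact (((hA.comp (by fun_prop) fun u hu ↦ memA u hu _ ⟨by linarith, by linarith⟩).add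
        continuousOn_const).sub continuousOn_const).sub
        (hΘ.comp (by fun_prop) fun u hu ↦ memΘ _ (hqr u hu) _ one_pos)
    · intro r hr
      rw [Complex.exp_sub, Complex.exp_sub, Complex.exp_add, two_mul, Complex.exp_add, hm, hN,
        mul_one, div_one, hAexp _ (memA r hr _ ⟨by linarith, by linarith⟩),
        hΘexp _ (memΘ _ (hqr r hr) _ one_pos)]
      refine re_div_pos_of_norm_sub_lt ?_
      have := hbox r hr 1 mem1 1 mem1
      rw [hq1, sub_self, h.zero _ (hqr r hr).1] at this
      convert this using 2
      ring
    · rw [hAm 1 ⟨by linarith, by linarith⟩, hq0]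
      convert h2 using 3
      ring
  rw [hAN 1 ⟨by linarith, by linarith⟩] at h3
  have h4 : |(N - m).im| < Real.pi / 4 := by
    have : (Θ (a, 1) + N + N - 2 * m - Θ (a, 1)).im = 2 * (N - m).im := by
      simp
      ring
    rw [this, abs_mul, abs_two] at h3
    linarith
  have h5 : Complex.exp (N - m) = -1 := by rw [Complex.exp_sub, hN, hm, div_one]
  have h6 := congr_arg Complex.re h5
  rw [Complex.exp_re] at h6
  rw [abs_lt] at h4
  have h7 := Real.cos_pos_of_mem_Ioo (x := (N - m).im)
    ⟨by linarith [Real.pi_pos], by linarith [Real.pi_pos]⟩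
  have h8 := mul_pos (Real.exp_pos (N - m).re) h7
  rw [h6] at h8
  norm_num at h8

/-- A regular point is not an `ω`-limit point. -/
theorem not_frequently_dist_lt (h : IsDiscFlow ψ) (hint : ∀ z : ℂ, ‖z‖ < 1 → ∃ t, ψ t z ≠ z)
    {x p : ℂ} (hp : p ∈ regularSet ψ) :
    ∃ ε > 0, ¬ ∃ᶠ t in atTop, dist (ψ t x) p < ε := by
  obtain ⟨ρ, hρ, H⟩ := h.exists_flow_box hint hp
  refine ⟨ρ, hρ, fun hfreq ↦ ?_⟩
  rw [frequently_atTop] at hfreq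
  have hreg : ∀ z ∈ ball p ρ, ‖z‖ ≤ 1 → z ∈ regularSet ψ := fun z hz hz1 ↦ by
    refine ⟨hz1, ?_⟩
    by_contra! hcon
    have := (H z hz z hz).1 1 ⟨zero_le_one, le_rfl⟩
    simp [hcon] at this
  obtain ⟨t₀, -, ht₀⟩ := hfreq 0
  obtain ⟨t₃, ht₃, hd⟩ := hfreq (t₀ + 2)
  set y := ψ t₀ x with hy
  have hy1 : ‖y‖ ≤ 1 := h.norm_le _ _
  have hyr : y ∈ regularSet ψ := hreg y ht₀ hy1
  obtain ⟨R, hR, hRd⟩ : ∃ R, 2 ≤ R ∧ ψ R y ∈ ball p ρ :=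
    ⟨t₃ - t₀, by linarith, by rw [hy, h.add, sub_add_cancel]; exact hd⟩
  have hc : Continuous fun t ↦ ψ t y := h.comp_continuous continuous_id continuous_const
  have hseg : segment ℝ y (ψ R y) ⊆ ball p ρ := (convex_ball p ρ).segment_subset ht₀ hRd
  have hsegc : IsClosed (segment ℝ y (ψ R y)) := by
    rw [segment_eq_image]
    exact (isCompact_Icc.image (by fun_prop)).isClosed
  -- the closest pair of returns to the segment
  have hcomp : IsCompact ((Icc 0 R ×ˢ Icc 0 R) ∩ {e : ℝ × ℝ | ψ e.1 y ∈ segment ℝ y (ψ R y) ∧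
      ψ e.2 y ∈ segment ℝ y (ψ R y) ∧ e.1 + 2 ≤ e.2}) :=
    (isCompact_Icc.prod isCompact_Icc).inter_right <|
      (hsegc.preimage (hc.comp continuous_fst)).inter <|
        (hsegc.preimage (hc.comp continuous_snd)).inter <|
          isClosed_le (continuous_fst.add continuous_const) continuous_snd
  obtain ⟨⟨t₁, t₂⟩, ⟨⟨ht₁, ht₂⟩, hs₁, hs₂, ht₁₂⟩, hmin⟩ := hcomp.exists_isMinOn
    ⟨(0, R), ⟨⟨le_rfl, by linarith⟩, ⟨by linarith, le_rfl⟩⟩,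
      by simpa [h.zero y hy1] using left_mem_segment ℝ _ _, right_mem_segment ℝ _ _, by simpa⟩
    (f := fun e ↦ ‖ψ e.1 y - ψ e.2 y‖) (by fun_prop)
  simp only at ht₁ ht₂ hs₁ hs₂ ht₁₂
  replace hmin : ∀ s ∈ Icc 0 R, ∀ t ∈ Icc 0 R, ψ s y ∈ segment ℝ y (ψ R y) →
      ψ t y ∈ segment ℝ y (ψ R y) → s + 2 ≤ t → ‖ψ t₁ y - ψ t₂ y‖ ≤ ‖ψ s y - ψ t y‖ :=
    fun s hs t ht h1 h2 h3 ↦ hmin (a := (s, t)) ⟨⟨hs, ht⟩, h1, h2, h3⟩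
  have hadd : ∀ t, ψ t (ψ t₁ y) = ψ (t₁ + t) y := fun t ↦ by rw [h.add, add_comm]
  have hb : ψ (t₂ - t₁) (ψ t₁ y) = ψ t₂ y := by rw [hadd, add_sub_cancel]
  have hne : ψ t₁ y ≠ ψ t₂ y := h.flow_ne_flow hint hyr (by linarith)
  have hpos : 0 < ‖ψ t₁ y - ψ t₂ y‖ := norm_pos_iff.2 (sub_ne_zero.2 hne)
  have hqseg : ∀ u ∈ Icc (0 : ℝ) 1,
      ψ t₂ y + u • (ψ t₁ y - ψ t₂ y) ∈ segment ℝ y (ψ R y) := fun u hu ↦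
    (convex_segment _ _).segment_subset hs₂ hs₁ (by
      rw [segment_eq_image']
      exact mem_image_of_mem _ hu)
  have hqreg : ∀ u ∈ Icc (0 : ℝ) 1, ψ t₂ y + u • (ψ t₁ y - ψ t₂ y) ∈ regularSet ψ :=
    fun u hu ↦ hreg _ (hseg (hqseg u hu)) (by
      have := (convex_closedBall (0 : ℂ) 1).segment_subset (by simpa using hy1)
        (by simpa using h.norm_le R y) (hqseg u hu)
      simpa using this)
  refine h.false_of_closed_arc hint (a := ψ t₁ y) (T := t₂ - t₁) (by linarith)
    (q := fun u ↦ ψ t₂ y + u • (ψ t₁ y - ψ t₂ y)) (by fun_prop) (by simp [hb]) (by simp) hqreg ?_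
    fun u hu v hv ↦ (H _ (hseg (hqseg u hu)) _ (hseg (hqseg v hv))).1
  intro u hu t ht heq
  have hu' : u ∈ Icc (0 : ℝ) 1 := ⟨hu.1.le, hu.2.le⟩
  simp only [hadd] at heq
  have hmem : t₁ + t ∈ Icc 0 R := ⟨by linarith [ht₁.1, ht.1], by linarith [ht₂.2, ht.2]⟩
  have hs : ψ (t₁ + t) y ∈ segment ℝ y (ψ R y) := heq ▸ hqseg u hu'
  rcases le_or_gt 2 t with h2 | h2
  · have := hmin t₁ ht₁ (t₁ + t) hmem hs₁ hs (by linarith)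
    rw [← heq, show ψ t₁ y - (ψ t₂ y + u • (ψ t₁ y - ψ t₂ y)) =
      (1 - u) • (ψ t₁ y - ψ t₂ y) by module, norm_smul, Real.norm_of_nonneg (by linarith [hu.2])]
      at this
    nlinarith [hu.1]
  rcases le_or_gt 2 (t₂ - t₁ - t) with h3 | h3
  · have := hmin (t₁ + t) hmem t₂ ht₂ hs hs₂ (by linarith)
    rw [← heq, add_sub_cancel_left, norm_smul, Real.norm_of_nonneg hu.1.le] at this
    nlinarith [hu.2]
  · exact (H _ (hseg hs₁) _ (hseg hs₂)).2 (t₂ - t₁) ⟨by linarith, by linarith⟩ hb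

/-- If the singular points are uniformly separated, every orbit converges. -/
theorem exists_tendsto (h : IsDiscFlow ψ) (hint : ∀ z : ℂ, ‖z‖ < 1 → ∃ t, ψ t z ≠ z)
    {δ : ℝ} (hδ : 0 < δ)
    (hsep : ∀ b c : ℂ, (∀ t, ψ t b = b) → (∀ t, ψ t c = c) → dist b c < δ → b = c)
    {x : ℂ} : ∃ b, Tendsto (fun t ↦ ψ t x) atTop (𝓝 b) := by
  have hc : Continuous fun t ↦ ψ t x := h.comp_continuous continuous_id continuous_const
  have hsing : ∀ b, ‖b‖ ≤ 1 → MapClusterPt b atTop (fun t ↦ ψ t x) → ∀ t, ψ t b = b := by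
    intro b hb hcl
    by_contra! hcon
    obtain ⟨ε, hε, hfreq⟩ := h.not_frequently_dist_lt hint ⟨hb, hcon⟩
    exact hfreq (hcl.frequently (ball_mem_nhds b hε))
  obtain ⟨b, hb, hbcl⟩ := (isCompact_closedBall (0 : ℂ) 1).exists_mapClusterPt
    (f := atTop) (u := fun t ↦ ψ t x)
    (tendsto_principal.2 <| Eventually.of_forall fun t ↦ by simpa using h.norm_le t x)
  have hbs := hsing b (by simpa using hb) hbcl
  refine ⟨b, Metric.tendsto_nhds.2 fun ε hε ↦ ?_⟩
  set η := min ε (δ / 2) with hη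
  have hη0 : 0 < η := lt_min hε (half_pos hδ)
  let V : Set ℂ := ⋃ c ∈ {c | (∀ t, ψ t c = c) ∧ c ≠ b}, ball c η
  have hV : IsOpen V := isOpen_biUnion fun _ _ ↦ isOpen_ball
  have hdisj : Disjoint (ball b η) V := by
    rw [disjoint_iUnion₂_right]
    rintro c ⟨hcs, hcb⟩
    refine ball_disjoint_ball ?_
    by_contra! hlt
    refine hcb (hsep b c hbs hcs (hlt.trans_le ?_)).symm
    linarith [min_le_right ε (δ / 2)]
  have hev : ∀ᶠ t in atTop, ψ t x ∈ ball b η ∪ V := by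
    by_contra hcon
    rw [not_eventually] at hcon
    obtain ⟨c, hcm, hcl⟩ := ((isCompact_closedBall (0 : ℂ) 1).diff
      (isOpen_ball.union hV)).exists_mapClusterPt_of_frequently
      (l := atTop) (f := fun t ↦ ψ t x) (hcon.mono fun t ht ↦ ⟨by simpa using h.norm_le t x, ht⟩)
    have hcs := hsing c (by simpa using hcm.1) hcl
    refine hcm.2 ?_
    by_cases hcb : c = b
    · exact Or.inl (hcb ▸ mem_ball_self hη0)
    · exact Or.inr (mem_biUnion (show c ∈ {c | (∀ t, ψ t c = c) ∧ c ≠ b} from ⟨hcs, hcb⟩)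
        (mem_ball_self hη0))
  obtain ⟨T, hT⟩ := eventually_atTop.1 hev
  obtain ⟨t₀, ht₀, hbt⟩ := frequently_atTop.1 (hbcl.frequently (ball_mem_nhds b hη0)) T
  have hsub := (isPreconnected_Ici.image _ hc.continuousOn).subset_left_of_subset_union
    isOpen_ball hV hdisj (by rintro _ ⟨t, ht, rfl⟩; exact hT t ht)
    ⟨_, mem_image_of_mem _ ht₀, hbt⟩
  filter_upwards [eventually_ge_atTop T] with t ht
  exact (mem_ball.1 (hsub (mem_image_of_mem _ ht))).trans_le (min_le_left _ _)

/-- An orbit segment of a regular point has empty interior. -/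
theorem exists_notMem_orbit (h : IsDiscFlow ψ) (hint : ∀ z : ℂ, ‖z‖ < 1 → ∃ t, ψ t z ≠ z)
    {x : ℂ} (hx : x ∈ regularSet ψ) {r : ℝ} (hr : 0 < r) :
    ∃ y, dist y x < r ∧ ∀ s ∈ Icc (-1 : ℝ) 1, y ≠ ψ s x := by
  by_contra! hcon
  let g : Icc (-1 : ℝ) 1 → ℂ := fun s ↦ ψ s x
  have hg : IsEmbedding g :=
    (Continuous.isClosedEmbedding (h.comp_continuous continuous_subtype_val continuous_const)
      fun s t hst ↦ by
        by_contra hne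
        exact h.flow_ne_flow hint hx (Subtype.coe_injective.ne hne) hst).isEmbedding
  let y : ℝ → ℂ := fun θ ↦ x + (r / 2 : ℝ) * Complex.exp (θ * Complex.I)
  have hy : Continuous y := by fun_prop
  have hs : ∀ θ, ∃ s, g s = y θ := fun θ ↦ by
    obtain ⟨s, hs, hys⟩ := hcon (y θ) (by
      simp only [y, dist_eq_norm, add_sub_cancel_left, norm_mul, Complex.norm_exp_ofReal_mul_I,
        Complex.norm_real, Real.norm_of_nonneg (half_pos hr).le]
      linarith)
    exact ⟨⟨s, hs⟩, hys.symm⟩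
  choose s hs using hs
  have hsc : Continuous s := hg.continuous_iff.2 (hy.congr fun θ ↦ (hs θ).symm)
  have hper : s (Real.pi + Real.pi) = s 0 := hg.injective <| by
    rw [hs, hs]
    simp [y, ← two_mul, Complex.exp_two_pi_mul_I]
  have hne : ∀ θ, s θ ≠ s (θ + Real.pi) := fun θ heq ↦ by
    have := hs θ
    rw [heq, hs (θ + Real.pi)] at this
    simp only [y, Complex.ofReal_add, add_mul, Complex.exp_add, Complex.exp_pi_mul_I] at this
    have h1 : (r / 2 : ℝ) * Complex.exp (θ * Complex.I) = 0 := by linear_combination -this / 2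
    simp [hr.ne'] at h1
  have hcont : Continuous fun θ ↦ (s θ : ℝ) - s (θ + Real.pi) := by fun_prop
  obtain ⟨θ, -, hθ⟩ := intermediate_value_uIcc (a := 0) (b := Real.pi) hcont.continuousOn
    (show (0 : ℝ) ∈ _ by
      simp only [zero_add, hper, mem_uIcc]
      rcases le_total (s 0 : ℝ) (s Real.pi) with h0 | h0
      · left; constructor <;> linarith
      · right; constructor <;> linarith)
  exact hne θ (Subtype.ext (sub_eq_zero.1 hθ))

/-- Orbits of points in some open set are asymptotically close in both directions. -/
theorem exists_uniform (h : IsDiscFlow ψ) {η : ℝ} (hη : 0 < η)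
    (hconv : ∀ z, ∃ b, Tendsto (fun t ↦ ψ t z) atTop (𝓝 b))
    (hconv' : ∀ z, ∃ b, Tendsto (fun t ↦ ψ (-t) z) atTop (𝓝 b)) :
    ∃ z₀ : ℂ, ‖z₀‖ < 1 ∧ ∃ r > 0, ∃ n : ℕ, ∀ y, dist y z₀ < r → ∀ t : ℝ, n ≤ |t| →
      dist (ψ t y) (ψ t z₀) ≤ 2 * η := by
  let e := TopologicalSpace.denseSeq ℂ
  let F : ℕ × ℕ × ℕ → Set ℂ := fun k ↦ {z | ∀ t : ℝ, k.2.2 ≤ t →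
    dist (ψ t z) (e k.1) ≤ η ∧ dist (ψ (-t) z) (e k.2.1) ≤ η}
  have hF : ∀ k, IsClosed (F k) := fun k ↦ by
    simp only [F, ofPred_forall]
    refine isClosed_iInter fun t ↦ isClosed_iInter fun _ ↦ ?_
    have h1 : Continuous fun z ↦ ψ t z := h.comp_continuous continuous_const continuous_id
    have h2 : Continuous fun z ↦ ψ (-t) z := h.comp_continuous continuous_const continuous_id
    exact (isClosed_le (h1.dist continuous_const) continuous_const).inter
      (isClosed_le (h2.dist continuous_const) continuous_const)
  have hcov : ⋃ k, F k = univ := by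
    refine eq_univ_of_forall fun z ↦ mem_iUnion.2 ?_
    obtain ⟨b, hb⟩ := hconv z
    obtain ⟨c, hc⟩ := hconv' z
    obtain ⟨i, hi⟩ := (TopologicalSpace.denseRange_denseSeq ℂ).exists_dist_lt b hη
    obtain ⟨j, hj⟩ := (TopologicalSpace.denseRange_denseSeq ℂ).exists_dist_lt c hη
    have hev := (hb.eventually (isOpen_ball.mem_nhds (show b ∈ ball (e i) η from hi))).and
      (hc.eventually (isOpen_ball.mem_nhds (show c ∈ ball (e j) η from hj)))
    obtain ⟨T, hT⟩ := eventually_atTop.1 hev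
    obtain ⟨n, hn⟩ := exists_nat_ge T
    exact ⟨(i, j, n), fun t ht ↦ ⟨(hT t (hn.trans ht)).1.le, (hT t (hn.trans ht)).2.le⟩⟩
  obtain ⟨z₀, hz₀, hz₀m⟩ := (dense_iUnion_interior_of_closed hF hcov).exists_mem_open
    (isOpen_ball (x := (0 : ℂ)) (ε := 1)) ⟨0, mem_ball_self one_pos⟩
  obtain ⟨⟨i, j, n⟩, hk⟩ := mem_iUnion.1 hz₀
  obtain ⟨r, hr, hball⟩ := Metric.isOpen_iff.1 isOpen_interior _ hk
  refine ⟨z₀, mem_ball_zero_iff.1 hz₀m, r, hr, n, fun y hy t ht ↦ ?_⟩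
  have h1 := interior_subset (hball hy)
  have h2 := interior_subset hk
  rcases abs_choice t with habs | habs
  · rw [habs] at ht
    have := dist_triangle_right (ψ t y) (ψ t z₀) (e i)
    linarith [(h1 t ht).1, (h2 t ht).1]
  · rw [habs] at ht
    have := dist_triangle_right (ψ t y) (ψ t z₀) (e j)
    have h3 := (h1 (-t) ht).2
    have h4 := (h2 (-t) ht).2
    rw [neg_neg] at h3 h4
    linarith

/-- An expansive flow on the disc has an interior singular point. -/
theorem exists_singular (h : IsDiscFlow ψ) {δ : ℝ} (hδ : 0 < δ)
    (hexp : ∀ x y : ℂ, ‖x‖ ≤ 1 → ‖y‖ ≤ 1 → (∀ t, dist (ψ t x) (ψ t y) < δ) →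
      ∃ s, |s| < 1 ∧ y = ψ s x) : ∃ z : ℂ, ‖z‖ < 1 ∧ ∀ t, ψ t z = z := by
  by_contra! hint
  have hint' : ∀ z : ℂ, ‖z‖ < 1 → ∃ t, ψ (-t) z ≠ z := fun z hz ↦ by
    obtain ⟨t, ht⟩ := hint z hz
    exact ⟨-t, by rwa [neg_neg]⟩
  have hsep : ∀ b c : ℂ, (∀ t, ψ t b = b) → (∀ t, ψ t c = c) → dist b c < δ → b = c := by
    intro b c hb hc hbc
    obtain ⟨s, -, hs⟩ := hexp b c (hb 0 ▸ h.norm_le _ _) (hc 0 ▸ h.norm_le _ _)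
      fun t ↦ by rwa [hb, hc]
    rw [hs, hb]
  obtain ⟨z₀, hz₀, r, hr, n, hn⟩ := h.exists_uniform (η := δ / 3) (by positivity)
    (fun _ ↦ h.exists_tendsto hint hδ hsep)
    (fun _ ↦ h.reverse.exists_tendsto hint' hδ
      (fun b c hb hc ↦ hsep b c (fun t ↦ by simpa using hb (-t)) fun t ↦ by simpa using hc (-t)))
  have hclose : ∀ᶠ y in 𝓝 z₀, ∀ t ∈ Icc (-n : ℝ) n, dist (ψ t z₀) (ψ t y) < δ := by
    refine isCompact_Icc.eventually_forall_of_forall_eventually fun t _ ↦ ?_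
    have h1 : Continuous fun e : ℂ × ℝ ↦ dist (ψ e.2 z₀) (ψ e.2 e.1) :=
      (h.comp_continuous continuous_snd continuous_const).dist
        (h.comp_continuous continuous_snd continuous_fst)
    exact h1.continuousAt.eventually_lt continuousAt_const (by simpa using hδ)
  have hev := (hclose.and (ball_mem_nhds z₀ hr)).and
    (isOpen_ball.mem_nhds (mem_ball_zero_iff.2 hz₀))
  obtain ⟨r', hr', H⟩ := Metric.eventually_nhds_iff.1 hev
  obtain ⟨y, hy, hyne⟩ := h.exists_notMem_orbit hint ⟨hz₀.le, hint z₀ hz₀⟩ hr'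
  obtain ⟨⟨hy1, hy2⟩, hy3⟩ := H hy
  obtain ⟨s, hs, hys⟩ := hexp z₀ y hz₀.le (mem_ball_zero_iff.1 hy3).le fun t ↦ by
    rcases le_total |t| n with ht | ht
    · exact hy1 t (abs_le.1 ht)
    · rw [dist_comm]
      linarith [hn y hy2 t ht]
  exact hyne s (abs_le.1 hs.le) hys

end IsDiscFlow

/-- A kinematic expansive flow on the closed unit disc has an interior
singular point. -/
theorem stmt12
    (φ : ℝ → (Metric.closedBall (0 : EuclideanSpace ℝ (Fin 2)) 1) →
      (Metric.closedBall (0 : EuclideanSpace ℝ (Fin 2)) 1))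
    (hφ : IsFlow φ) (hke : KinematicExpansive φ) :
    ∃ p : Metric.closedBall (0 : EuclideanSpace ℝ (Fin 2)) 1,
      ‖(p : EuclideanSpace ℝ (Fin 2))‖ < 1 ∧ ∀ t : ℝ, φ t p = p := by
  obtain ⟨hcont, hzero, hadd⟩ := hφ
  let J : EuclideanSpace ℝ (Fin 2) ≃ₗᵢ[ℝ] ℂ := Complex.orthonormalBasisOneI.repr.symm
  let ρ : ℂ → closedBall (0 : EuclideanSpace ℝ (Fin 2)) 1 := fun z ↦
    ⟨(max 1 ‖z‖)⁻¹ • J.symm z, by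
      have h1 : 0 < max 1 ‖z‖ := lt_max_of_lt_left one_pos
      rw [mem_closedBall_zero_iff, norm_smul, norm_inv, Real.norm_of_nonneg h1.le,
        J.symm.norm_map, inv_mul_le_one₀ h1]
      exact le_max_right _ _⟩
  have hρ : Continuous ρ := by
    refine Continuous.subtype_mk (((continuous_const.max continuous_norm).inv₀ fun z ↦ ?_).smul
      J.symm.continuous) _
    exact (lt_max_of_lt_left one_pos).ne'
  have hρJ : ∀ p : closedBall (0 : EuclideanSpace ℝ (Fin 2)) 1, ρ (J p) = p := fun p ↦ by
    refine Subtype.ext ?_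
    have := mem_closedBall_zero_iff.1 p.2
    simp [ρ, max_eq_left this]
  have hJρ : ∀ z : ℂ, ‖z‖ ≤ 1 → J (ρ z) = z := fun z hz ↦ by
    simp [ρ, max_eq_left hz]
  have hψ : IsDiscFlow fun t z ↦ J (φ t (ρ z)) :=
    { continuous := J.continuous.comp <| continuous_subtype_val.comp <|
        hcont.comp (continuous_fst.prodMk (hρ.comp continuous_snd))
      norm_le := fun t z ↦ by
        rw [J.norm_map]
        exact mem_closedBall_zero_iff.1 (φ t (ρ z)).2
      zero := fun z hz ↦ by rw [hzero, hJρ z hz]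
      add := fun s t z ↦ by rw [hρJ, hadd] }
  obtain ⟨δ, hδ, hexp⟩ := hke 1 one_pos
  obtain ⟨z, hz, hfix⟩ := hψ.exists_singular hδ fun x y hx hy hxy ↦ by
    obtain ⟨s, hs, hys⟩ := hexp (ρ x) (ρ y) fun t ↦ by
      have := hxy t
      rwa [J.dist_map] at this
    exact ⟨s, hs, by rw [← hys, hJρ y hy]⟩
  refine ⟨ρ z, ?_, fun t ↦ ?_⟩
  · rw [← J.norm_map, hJρ z hz.le]
    exact hz
  · rw [← hρJ (φ t (ρ z)), hfix t]
end
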